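/- Let δ be an irreducible non-planar curve of degree e in ℂP^d, d ≥ 3. Then there are at most O(e^4) points p on δ such that the projection π_p restricted to δ∖{p} is not generically one-to-one. -/

import Mathlib

open scoped Pointwise
open Classical

noncomputable section

/-- `n`-dimensional projective space over `𝔽`. -/
abbrev PS (𝔽 : Type) [Field 𝔽] (n : ℕ) := Projectivization 𝔽 (Fin (n + 1) → 𝔽)

/-- A projective flat of projective dimension `r - 1` (linear rank `r`), as a set of points. -/
def IsFlatOfRank {𝔽 : Type} [Field 𝔽] {n : ℕ} (r : ℕ) (S : Set (PS 𝔽 n)) : Prop :=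
  ∃ W : Submodule 𝔽 (Fin (n + 1) → 𝔽), Module.finrank 𝔽 W = r ∧ S = {x | x.submodule ≤ W}

/-- A hyperplane of `PS 𝔽 n`, as a set of points. -/
def IsHypSet {𝔽 : Type} [Field 𝔽] {n : ℕ} (S : Set (PS 𝔽 n)) : Prop := IsFlatOfRank n S

/-- The linear span of a set of projective points. -/
def projSpan {𝔽 : Type} [Field 𝔽] {n : ℕ} (S : Set (PS 𝔽 n)) : Submodule 𝔽 (Fin (n + 1) → 𝔽) :=
  ⨆ x ∈ S, x.submodule

/-- Every `d` points of `P` span a hyperplane (of `PS 𝔽 d`). -/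
def SpanEveryd {𝔽 : Type} [Field 𝔽] {n : ℕ} (d : ℕ) (P : Set (PS 𝔽 n)) : Prop :=
  ∀ S : Set (PS 𝔽 n), S ⊆ P → S.Finite → S.ncard = d → Module.finrank 𝔽 (projSpan S) = d

/-- The hyperplanes passing through exactly `k` points of `P`. -/
def hypThrough {𝔽 : Type} [Field 𝔽] {n : ℕ} (P : Set (PS 𝔽 n)) (k : ℕ) :
    Set (Submodule 𝔽 (Fin (n + 1) → 𝔽)) :=
  {W | Module.finrank 𝔽 W = n ∧ ({x ∈ P | x.submodule ≤ W}).ncard = k}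

/-- The number of hyperplanes passing through exactly `k` points of `P`.
`numHyp P n` is the number of ordinary hyperplanes of `P ⊆ PS 𝔽 n`;
`numHyp P (n+1)` is the number of `(n+1)`-point hyperplanes. -/
def numHyp {𝔽 : Type} [Field 𝔽] {n : ℕ} (P : Set (PS 𝔽 n)) (k : ℕ) : ℕ :=
  (hypThrough P k).ncard
/-- The projective zero locus of a set of (homogeneous) polynomials. -/
def projZeroLocus {n : ℕ} (S : Set (MvPolynomial (Fin (n + 1)) ℂ)) : Set (PS ℂ n) :=
  {x | ∀ f ∈ S, ∀ v ∈ x.submodule, MvPolynomial.eval v f = 0}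

/-- A (closed, projective) algebraic set in `ℂPⁿ`. -/
def IsAlg {n : ℕ} (V : Set (PS ℂ n)) : Prop :=
  ∃ S : Set (MvPolynomial (Fin (n + 1)) ℂ),
    (∀ f ∈ S, ∃ e, f.IsHomogeneous e) ∧ V = projZeroLocus S

/-- The Zariski closure of a set of points of `ℂPⁿ`. -/
def zclosure {n : ℕ} (A : Set (PS ℂ n)) : Set (PS ℂ n) :=
  ⋂₀ {V | IsAlg V ∧ A ⊆ V}

/-- An irreducible algebraic set in `ℂPⁿ`. -/
def IsIrredAlg {n : ℕ} (V : Set (PS ℂ n)) : Prop :=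
  IsAlg V ∧ V.Nonempty ∧
    ∀ V₁ V₂ : Set (PS ℂ n), IsAlg V₁ → IsAlg V₂ → V ⊆ V₁ ∪ V₂ → V ⊆ V₁ ∨ V ⊆ V₂

/-- An irreducible component of an algebraic set. -/
def IsComponentOf {n : ℕ} (C V : Set (PS ℂ n)) : Prop :=
  IsIrredAlg C ∧ C ⊆ V ∧ ∀ C' : Set (PS ℂ n), IsIrredAlg C' → C' ⊆ V → C ⊆ C' → C = C'

/-- `V` is non-degenerate: it is not contained in a hyperplane. -/
def NonDeg {n : ℕ} (V : Set (PS ℂ n)) : Prop := ∀ S : Set (PS ℂ n), IsHypSet S → ¬V ⊆ S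

/-- `V` is non-planar: it is not contained in a 2-flat. -/
def NonPlanar {n : ℕ} (V : Set (PS ℂ n)) : Prop := ∀ S : Set (PS ℂ n), IsFlatOfRank 3 S → ¬V ⊆ S

/-- A projective variety of pure dimension 1: it is algebraic, some hyperplane meets it in
finitely many points (dimension at most 1), and every irreducible component is infinite
(dimension at least 1). -/
def IsPureCurve {n : ℕ} (V : Set (PS ℂ n)) : Prop :=
  IsAlg V ∧ (∃ S : Set (PS ℂ n), IsHypSet S ∧ (V ∩ S).Finite) ∧
    ∀ C, IsComponentOf C V → C.Infinite

/-- A curve of degree `e` in `ℂPⁿ`: a pure 1-dimensional variety such that the maximum number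
of points in a finite intersection with a hyperplane is `e`. -/
def IsCurveDeg {n : ℕ} (V : Set (PS ℂ n)) (e : ℕ) : Prop :=
  IsPureCurve V ∧
    IsGreatest {m : ℕ | ∃ S : Set (PS ℂ n), IsHypSet S ∧ (V ∩ S).Finite ∧ (V ∩ S).ncard = m} e

/-- All homogeneous polynomials vanishing on `V`. -/
def vanishingForms {n : ℕ} (V : Set (PS ℂ n)) : Set (MvPolynomial (Fin (n + 1)) ℂ) :=
  {f | (∃ e, f.IsHomogeneous e) ∧ ∀ x ∈ V, ∀ v ∈ x.submodule, MvPolynomial.eval v f = 0}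

/-- The (affine cone of the) Zariski tangent space of `V` at `x`. -/
def tangentSpaceAt {n : ℕ} (V : Set (PS ℂ n)) (x : PS ℂ n) : Submodule ℂ (Fin (n + 1) → ℂ) :=
  ⨅ f ∈ vanishingForms V,
    LinearMap.ker (∑ i : Fin (n + 1),
      MvPolynomial.eval x.rep (MvPolynomial.pderiv i f) •
        (LinearMap.proj i : (Fin (n + 1) → ℂ) →ₗ[ℂ] ℂ))

/-- A smooth point of a curve `V`: the tangent space has (affine) dimension 2. -/
def IsSmoothPt {n : ℕ} (V : Set (PS ℂ n)) (x : PS ℂ n) : Prop :=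
  x ∈ V ∧ Module.finrank ℂ (tangentSpaceAt V x) = 2

/-- The set of smooth points of a curve `V`. -/
def smoothPts {n : ℕ} (V : Set (PS ℂ n)) : Set (PS ℂ n) := {x | IsSmoothPt V x}

/-- A smooth curve. -/
def IsSmoothCurve {n : ℕ} (V : Set (PS ℂ n)) : Prop := ∀ x ∈ V, IsSmoothPt V x

/-- A real point of `ℂPⁿ`: one admitting a representative vector with real coordinates. -/
def IsRealPt {n : ℕ} (x : PS ℂ n) : Prop := ∃ v ∈ x.submodule, v ≠ 0 ∧ ∀ i, (v i).im = 0

/-- A real curve: each irreducible component contains infinitely many real points. -/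
def IsRealCurve {n : ℕ} (V : Set (PS ℂ n)) : Prop :=
  ∀ C, IsComponentOf C V → {x ∈ C | IsRealPt x}.Infinite

/-- The natural embedding `ℝPⁿ → ℂPⁿ`. -/
def cx {n : ℕ} (x : PS ℝ n) : PS ℂ n :=
  Projectivization.mk ℂ (fun i => (x.rep i : ℂ)) (by
    intro hc
    apply x.rep_nonzero
    funext i
    have h := congrFun hc i
    simp only [Pi.zero_apply] at h ⊢
    exact_mod_cast h)
/-- The image of a set `A ⊆ ℂPⁿ⁺¹` under the projection induced by the linear map `f`. -/
def projImage {n : ℕ} (f : (Fin (n + 2) → ℂ) →ₗ[ℂ] (Fin (n + 1) → ℂ))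
    (A : Set (PS ℂ (n + 1))) : Set (PS ℂ n) :=
  {y | ∃ x ∈ A, ∃ h : f x.rep ≠ 0, y = Projectivization.mk ℂ (f x.rep) h}

/-- The projection induced by `f` is generically one-to-one on `A`: it is injective away
from some finite subset of `A`. -/
def GenOneToOneOn {n : ℕ} (f : (Fin (n + 2) → ℂ) →ₗ[ℂ] (Fin (n + 1) → ℂ))
    (A : Set (PS ℂ (n + 1))) : Prop :=
  ∃ S : Set (PS ℂ (n + 1)), S.Finite ∧
    ∀ x₁ ∈ A \ S, ∀ x₂ ∈ A \ S,
      (∃ c : ℂ, c ≠ 0 ∧ f x₁.rep = c • f x₂.rep) → x₁ = x₂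

/-- A nontrivial finitely generated `ℂ`-algebra has a complex point; here for the algebra generated
by a finite subset of a field. -/
theorem exists_specialization {Ω : Type*} [Field Ω] [Algebra ℂ Ω] {s : Set Ω} (hs : s.Finite) :
    ∃ (A : Subalgebra ℂ Ω) (_ : A →ₐ[ℂ] ℂ), s ⊆ A := by
  let A := Algebra.adjoin ℂ s
  have hfg : Algebra.FiniteType ℂ A := by
    have h := Subalgebra.fg_adjoin_finset (R := ℂ) hs.toFinset
    rw [hs.coe_toFinset] at h
    exact (Subalgebra.fg_iff_finiteType _).1 h
  obtain ⟨m, hm⟩ := Ideal.exists_maximal A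
  let := Ideal.Quotient.field m
  have : Algebra.FiniteType ℂ (A ⧸ m) :=
    .of_surjective (Ideal.Quotient.mkₐ ℂ m) (Ideal.Quotient.mkₐ_surjective ℂ m)
  have hfin : Module.Finite ℂ (A ⧸ m) := finite_of_finite_type_of_isJacobsonRing ℂ (A ⧸ m)
  have hbij := IsAlgClosed.algebraMap_bijective_of_isIntegral (k := ℂ) (K := A ⧸ m)
  exact ⟨A, (AlgEquiv.ofBijective (Algebra.ofId ℂ (A ⧸ m)) hbij).symm.toAlgHom.comp
    (Ideal.Quotient.mkₐ ℂ m), Algebra.subset_adjoin⟩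

theorem MvPolynomial.IsHomogeneous.aeval_mul {σ A : Type*} [CommRing A] [Algebra ℂ A]
    {G : MvPolynomial σ ℂ} {d : ℕ} (hG : G.IsHomogeneous d) (a : A) (ξ : σ → A) :
    MvPolynomial.aeval (fun i => a * ξ i) G = a ^ d * MvPolynomial.aeval ξ G := by
  simp only [MvPolynomial.aeval_def, MvPolynomial.eval₂_eq, Finset.mul_sum]
  refine Finset.sum_congr rfl fun m hm => ?_
  have h : ∑ i ∈ m.support, m i = d := by
    simpa [Finsupp.weight_apply, Finsupp.sum] using hG (MvPolynomial.mem_support_iff.1 hm)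
  simp_rw [mul_pow, Finset.prod_mul_distrib, Finset.prod_pow_eq_pow_sum, h]
  ring

/-- If homogeneous forms vanishing at `ξ` together with `ℓ₀` and `ℓ₁` have no nontrivial common
zero and `ℓ₀(ξ) = 1`, then the coordinates of `ξ` are integral over `ℂ[ℓ₁(ξ)]`. -/
theorem isIntegral_coord_of_no_common_zero {σ Ω : Type*} [Finite σ] [Field Ω] [Algebra ℂ Ω]
    (ξ : σ → Ω) (T : Set (MvPolynomial σ ℂ)) (hT : ∀ G ∈ T, ∃ d, G.IsHomogeneous d)
    (hTξ : ∀ G ∈ T, MvPolynomial.aeval ξ G = 0) (l₀ l₁ : MvPolynomial σ ℂ)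
    (hl₀ : l₀.IsHomogeneous 1) (hl₁ : l₁.IsHomogeneous 1) (h₀ : MvPolynomial.aeval ξ l₀ = 1)
    (hzero : ∀ c : σ → ℂ, (∀ G ∈ T, MvPolynomial.eval c G = 0) → MvPolynomial.eval c l₀ = 0 →
      MvPolynomial.eval c l₁ = 0 → c = 0) (i : σ) :
    IsIntegral (Algebra.adjoin ℂ {MvPolynomial.aeval ξ l₁}) (ξ i) := by
  by_contra h_int
  set t := MvPolynomial.aeval ξ l₁ with ht
  let s : Set Ω := Algebra.adjoin ℂ {t}
  obtain ⟨V, hsV, hiV⟩ : ∃ V : ValuationSubring Ω, s ⊆ V ∧ ξ i ∉ V := by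
    by_contra! hV
    have hmem : ξ i ∈ (integralClosure (Subring.closure s) Ω).toSubring := by
      rw [← iInf_valuationSubring_superset, Subring.mem_iInf]
      exact fun V => hV V.1 V.2
    obtain ⟨P, hP, hPe⟩ : IsIntegral (Subring.closure s) (ξ i) := hmem
    have hle : Subring.closure s ≤ (Algebra.adjoin ℂ {t}).toSubring := Subring.closure_le.2 le_rfl
    refine h_int ⟨P.map (Subring.inclusion hle), hP.map _, ?_⟩
    rw [Polynomial.eval₂_map]
    exact hPe
  have hℂ : ∀ z : ℂ, algebraMap ℂ Ω z ∈ V := fun z => hsV (Subalgebra.algebraMap_mem _ z)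
  have htV : t ∈ V := hsV (Algebra.subset_adjoin rfl)
  have : Nonempty σ := ⟨i⟩
  obtain ⟨j, hj⟩ := Finite.exists_max fun k => V.valuation (ξ k)
  have hj1 : 1 < V.valuation (ξ j) :=
    lt_of_lt_of_le (lt_of_not_ge fun h => hiV ((V.valuation_le_one_iff _).1 h)) (hj i)
  have hj0 : ξ j ≠ 0 := by
    rintro h
    simp [h] at hj1
  let : Algebra ℂ V := ((algebraMap ℂ Ω).codRestrict V.toSubring hℂ).toAlgebra
  let ι : V →ₐ[ℂ] Ω := { V.subtype with commutes' := fun _ => rfl }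
  have hι : Function.Injective ι := Subtype.val_injective
  let η : σ → V := fun k => ⟨(ξ j)⁻¹ * ξ k, (V.valuation_le_one_iff _).1 (by
    rw [map_mul, map_inv₀]
    exact inv_mul_le_one_of_le₀ (hj k) zero_le)⟩
  have hη : ∀ (G : MvPolynomial σ ℂ) (d : ℕ), G.IsHomogeneous d →
      ι (MvPolynomial.aeval η G) = (ξ j)⁻¹ ^ d * MvPolynomial.aeval ξ G := by
    intro G d hG
    rw [← hG.aeval_mul, MvPolynomial.comp_aeval_apply]
    rfl
  have hjV : (ξ j)⁻¹ ∈ V := (V.valuation_le_one_iff _).1 (by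
    rw [map_inv₀]
    exact inv_le_one_of_one_le₀ hj1.le)
  have hinv : (⟨(ξ j)⁻¹, hjV⟩ : V) ∈ IsLocalRing.maximalIdeal V := by
    refine (V.valuation_lt_one_iff _).2 ?_
    simpa using inv_lt_one_of_one_lt₀ hj1
  let κ := IsLocalRing.ResidueField V
  let ρ : V →ₐ[ℂ] κ := { IsLocalRing.residue V with commutes' := fun _ => rfl }
  obtain ⟨A, φ, hA⟩ := exists_specialization (Set.finite_range fun k => ρ (η k))
  let c : σ → ℂ := fun k => φ ⟨ρ (η k), hA ⟨k, rfl⟩⟩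
  have key : ∀ G : MvPolynomial σ ℂ, ρ (MvPolynomial.aeval η G) = 0 → MvPolynomial.eval c G = 0 := by
    intro G hG
    have h1 : MvPolynomial.aeval (fun k => (⟨ρ (η k), hA ⟨k, rfl⟩⟩ : A)) G = 0 := by
      apply Subtype.val_injective
      rw [← A.val_apply, MvPolynomial.comp_aeval_apply]
      rw [MvPolynomial.comp_aeval_apply] at hG
      exact hG
    have h2 := congrArg φ h1
    rw [MvPolynomial.comp_aeval_apply, map_zero] at h2
    exact h2
  have hc : c = 0 := by
    refine hzero c (fun G hG => key G ?_) (key _ ?_) (key _ ?_)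
    · obtain ⟨d, hd⟩ := hT G hG
      have : MvPolynomial.aeval η G = 0 := hι (by rw [hη G d hd, hTξ G hG]; simp)
      rw [this, map_zero]
    · have : MvPolynomial.aeval η l₀ = ⟨(ξ j)⁻¹, hjV⟩ :=
        hι (by rw [hη _ 1 hl₀, h₀, pow_one, mul_one]; rfl)
      rw [this]
      exact (IsLocalRing.residue_eq_zero_iff _).2 hinv
    · have : MvPolynomial.aeval η l₁ = ⟨(ξ j)⁻¹, hjV⟩ * ⟨t, htV⟩ :=
        hι (by rw [hη _ 1 hl₁, pow_one]; rfl)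
      rw [this]
      exact (IsLocalRing.residue_eq_zero_iff _).2 (Ideal.mul_mem_right _ _ hinv)
  have hcj : c j = 1 := by
    have h1 : η j = 1 := Subtype.ext (inv_mul_cancel₀ hj0)
    have h2 : (⟨ρ (η j), hA ⟨j, rfl⟩⟩ : A) = 1 := 
      Subtype.ext ((congrArg ρ h1).trans (map_one ρ))
    simp only [c, h2, map_one]
  rw [hc] at hcj
  simp at hcj

theorem transcendental_of_not_mem_range {Ω : Type*} [Field Ω] [Algebra ℂ Ω] {u : Ω}
    (hu : u ∉ Set.range (algebraMap ℂ Ω)) : Transcendental ℂ u := fun h =>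
  hu ((IsAlgClosed.algebraMap_bijective_of_isIntegral (k := ℂ) (K := integralClosure ℂ Ω)).2
    ⟨u, h.isIntegral⟩ |>.imp fun _ h => congrArg Subtype.val h)

/-- In a field algebraic over `ℂ[t]`, every nonconstant element `u` generates a subalgebra over which
the field is algebraic. -/
theorem isAlgebraic_adjoin_of_not_mem_range {Ω : Type*} [Field Ω] [Algebra ℂ Ω] (t u : Ω)
    [Algebra.IsAlgebraic (Algebra.adjoin ℂ {t}) Ω] (hu : u ∉ Set.range (algebraMap ℂ Ω)) :
    Algebra.IsAlgebraic (Algebra.adjoin ℂ {u}) Ω := by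
  have hle : Algebra.trdeg ℂ Ω ≤ 1 := by
    simpa using Algebra.IsAlgebraic.trdeg_le_cardinalMk ℂ ({t} : Set Ω)
  have hind : AlgebraicIndependent ℂ (fun _ : Unit => u) :=
    (algebraicIndependent_unique_type_iff).2 (transcendental_of_not_mem_range hu)
  have := hind.isTranscendenceBasis_of_lift_trdeg_le (hle.trans_lt Cardinal.one_lt_aleph0)
    (by simpa using hle)
  have h2 := this.isAlgebraic
  rwa [Set.range_const] at h2

/-- If `Ω` is algebraic over `ℂ[u]`, it is algebraic over `ℂ[X]` acting through `X ↦ u`. -/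
theorem isAlgebraic_polynomial_of_adjoin {Ω : Type*} [Field Ω] [Algebra ℂ Ω] (u : Ω)
    [Algebra.IsAlgebraic (Algebra.adjoin ℂ {u}) Ω] [Algebra (Polynomial ℂ) Ω]
    (hu : algebraMap (Polynomial ℂ) Ω = (Polynomial.aeval u : Polynomial ℂ →ₐ[ℂ] Ω)) :
    Algebra.IsAlgebraic (Polynomial ℂ) Ω := by
  let f : Polynomial ℂ →+* Algebra.adjoin ℂ {u} :=
    ((Polynomial.aeval u : Polynomial ℂ →ₐ[ℂ] Ω) : Polynomial ℂ →+* Ω).codRestrict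
      (Algebra.adjoin ℂ {u}).toSubring fun P => Polynomial.aeval_mem_adjoin_singleton ℂ u
  refine Algebra.IsAlgebraic.of_ringHom_of_comp_eq f (RingHom.id Ω) ?_ Function.injective_id ?_
  · rintro ⟨w, hw⟩
    rw [Algebra.adjoin_singleton_eq_range_aeval] at hw
    obtain ⟨P, rfl⟩ := hw
    exact ⟨P, rfl⟩
  · rw [hu]
    rfl

/-- A field algebraic over `ℂ(t)` has a derivation with `D t = 1`. -/
theorem exists_derivation_eq_one {Ω : Type*} [Field Ω] [Algebra ℂ Ω] (t : Ω)
    (ht : Transcendental ℂ t) [Algebra.IsAlgebraic (Algebra.adjoin ℂ {t}) Ω] :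
    ∃ D : Derivation ℂ Ω Ω, D t = 1 := by
  let : Algebra (Polynomial ℂ) Ω := (Polynomial.aeval t : Polynomial ℂ →ₐ[ℂ] Ω).toAlgebra
  have : IsScalarTower ℂ (Polynomial ℂ) Ω := .of_algebraMap_eq fun z =>
    ((Polynomial.aeval t : Polynomial ℂ →ₐ[ℂ] Ω).commutes z).symm
  have : FaithfulSMul (Polynomial ℂ) Ω := (faithfulSMul_iff_algebraMap_injective _ _).2
    (transcendental_iff_injective.1 ht)
  have : Algebra.IsAlgebraic (Polynomial ℂ) Ω := isAlgebraic_polynomial_of_adjoin t rfl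
  let := FractionRing.liftAlgebra (Polynomial ℂ) Ω
  have := FractionRing.isScalarTower_liftAlgebra (Polynomial ℂ) Ω
  have : Algebra.IsAlgebraic (FractionRing (Polynomial ℂ)) Ω :=
    .extendScalars (IsFractionRing.injective (Polynomial ℂ) _)
  have : CharZero (FractionRing (Polynomial ℂ)) := charZero_of_injective_algebraMap
    (IsFractionRing.injective (Polynomial ℂ) _)
  have : Algebra.FormallyEtale (FractionRing (Polynomial ℂ)) Ω := .of_isSeparable _ _
  have : Algebra.FormallyEtale (Polynomial ℂ) (FractionRing (Polynomial ℂ)) :=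
    .of_isLocalization (nonZeroDivisors (Polynomial ℂ))
  have : Algebra.FormallyEtale (Polynomial ℂ) Ω := .comp _ (FractionRing (Polynomial ℂ)) _
  let d : Derivation ℂ (Polynomial ℂ) Ω := Polynomial.mkDerivation ℂ (1 : Ω)
  let L := (d.liftKaehlerDifferential.liftBaseChange Ω) ∘ₗ
    (KaehlerDifferential.tensorKaehlerEquivOfFormallyEtale ℂ (Polynomial ℂ) Ω).symm.toLinearMap
  refine ⟨L.compDer (KaehlerDifferential.D ℂ Ω), ?_⟩
  have htX : t = algebraMap (Polynomial ℂ) Ω Polynomial.X := (Polynomial.aeval_X t).symm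
  change L (KaehlerDifferential.D ℂ Ω t) = 1
  simp only [L, LinearMap.comp_apply, LinearEquiv.coe_coe]
  rw [htX, KaehlerDifferential.tensorKaehlerEquivOfFormallyEtale_symm_D_algebraMap]
  simp [d]

/-- Chain rule for derivations and multivariate polynomials. -/
theorem Derivation.map_mvPolynomial_aeval {σ A : Type*} [Fintype σ] [CommRing A] [Algebra ℂ A]
    (D : Derivation ℂ A A) (z : σ → A) (G : MvPolynomial σ ℂ) :
    D (MvPolynomial.aeval z G) =
      ∑ i, MvPolynomial.aeval z (MvPolynomial.pderiv i G) * D (z i) := by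
  induction G using MvPolynomial.induction_on with
  | C a => simp
  | add p q hp hq => simp [hp, hq, add_mul, Finset.sum_add_distrib]
  | mul_X p j hp =>
    simp only [map_mul, MvPolynomial.aeval_X, Derivation.leibniz, smul_eq_mul, hp,
      MvPolynomial.pderiv_X, map_add, add_mul, Finset.sum_add_distrib, Finset.mul_sum]
    congr 1
    · rw [Finset.sum_eq_single j]
      · simp
      · intro b _ hb; simp [hb.symm]
      · simp
    · exact Finset.sum_congr rfl fun i _ => by ring

theorem isAlgebraic_of_le_of_isIntegral {Ω : Type*} [Field Ω] [Algebra ℂ Ω] {A B : Subalgebra ℂ Ω}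
    (hle : A ≤ B) (h_int : ∀ x ∈ B, IsIntegral A x) [Algebra.IsAlgebraic B Ω] :
    Algebra.IsAlgebraic A Ω := by
  let := (Subalgebra.inclusion hle).toAlgebra
  have : IsScalarTower A B Ω := .of_algebraMap_eq fun _ => rfl
  have : Algebra.IsAlgebraic A B :=
    ⟨fun x => ((isIntegral_algebraMap_iff (Subtype.val_injective : Function.Injective
      (algebraMap B Ω))).1 (h_int x x.2)).isAlgebraic⟩
  exact .trans _ B _

/-- The linear polynomial attached to a linear form. -/
def linPoly {σ : Type*} [Fintype σ] (l : Module.Dual ℂ (σ → ℂ)) : MvPolynomial σ ℂ :=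
  ∑ i, MvPolynomial.C (l (Pi.single i 1)) * MvPolynomial.X i

theorem isHomogeneous_linPoly {σ : Type*} [Fintype σ] (l : Module.Dual ℂ (σ → ℂ)) :
    (linPoly l).IsHomogeneous 1 :=
  MvPolynomial.IsHomogeneous.sum _ _ _ fun i _ => by
    simpa using (MvPolynomial.isHomogeneous_C σ _).mul (MvPolynomial.isHomogeneous_X ℂ i)

/-- The value of a linear form at a point with coordinates in a `ℂ`-algebra. -/
def linEval {σ A : Type*} [Fintype σ] [CommRing A] [Algebra ℂ A] (l : Module.Dual ℂ (σ → ℂ))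
    (ξ : σ → A) : A :=
  ∑ i, l (Pi.single i 1) • ξ i

theorem aeval_linPoly {σ A : Type*} [Fintype σ] [CommRing A] [Algebra ℂ A]
    (l : Module.Dual ℂ (σ → ℂ)) (ξ : σ → A) :
    MvPolynomial.aeval ξ (linPoly l) = linEval l ξ := by
  simp [linPoly, linEval, Algebra.smul_def]

theorem linEval_complex {σ : Type*} [Fintype σ] (l : Module.Dual ℂ (σ → ℂ)) (v : σ → ℂ) :
    linEval l v = l v := by
  conv_rhs => rw [pi_eq_sum_univ' v]
  simp [linEval, mul_comm]

@[simp]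
theorem eval_linPoly {σ : Type*} [Fintype σ] (l : Module.Dual ℂ (σ → ℂ)) (v : σ → ℂ) :
    MvPolynomial.eval v (linPoly l) = l v := by
  rw [← linEval_complex, ← aeval_linPoly]
  rfl

/-- The affine chart `l₀ = 1` of the cone cut out by `T`. -/
def affinePart {σ : Type*} (T : Set (MvPolynomial σ ℂ)) (l₀ : Module.Dual ℂ (σ → ℂ)) :
    Set (σ → ℂ) :=
  {v | l₀ v = 1 ∧ ∀ G ∈ T, MvPolynomial.eval v G = 0}

/-- `ξ` is a generic point, normalised by `l₀(ξ) = 1`, of the cone over an irreducible curve cut out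
by the forms `T`, which meets `l₀ = l₁ = 0` only at the origin. -/
structure IsCurveGenericPoint {σ Ω : Type*} [Fintype σ] [Field Ω] [Algebra ℂ Ω]
    (T : Set (MvPolynomial σ ℂ)) (l₀ l₁ : Module.Dual ℂ (σ → ℂ)) (ξ : σ → Ω) : Prop where
  hom : ∀ G ∈ T, ∃ d, G.IsHomogeneous d
  aeval_eq_zero_iff : ∀ G, MvPolynomial.aeval ξ G = 0 ↔
    ∀ v ∈ affinePart T l₀, MvPolynomial.eval v G = 0
  eq_zero : ∀ c : σ → ℂ, (∀ G ∈ T, MvPolynomial.eval c G = 0) → l₀ c = 0 → l₁ c = 0 → c = 0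
  infinite : (affinePart T l₀).Infinite
  isAlgebraic : Algebra.IsAlgebraic (Algebra.adjoin ℂ (Set.range ξ)) Ω

namespace IsCurveGenericPoint

variable {σ Ω : Type*} [Fintype σ] [Field Ω] [Algebra ℂ Ω] {T : Set (MvPolynomial σ ℂ)}
  {l₀ l₁ : Module.Dual ℂ (σ → ℂ)} {ξ : σ → Ω}

theorem aeval_mem (h : IsCurveGenericPoint T l₀ l₁ ξ) {G : MvPolynomial σ ℂ} (hG : G ∈ T) :
    MvPolynomial.aeval ξ G = 0 :=
  (h.aeval_eq_zero_iff G).2 fun _ hv => hv.2 G hG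

theorem linEval_one (h : IsCurveGenericPoint T l₀ l₁ ξ) : linEval l₀ ξ = 1 := by
  have := (h.aeval_eq_zero_iff (linPoly l₀ - 1)).2 fun v hv => by simp [hv.1]
  rw [map_sub, map_one, aeval_linPoly] at this
  exact sub_eq_zero.1 this

theorem linEval_eq_zero_iff (h : IsCurveGenericPoint T l₀ l₁ ξ) (l : Module.Dual ℂ (σ → ℂ)) :
    linEval l ξ = 0 ↔ ∀ v ∈ affinePart T l₀, l v = 0 := by
  rw [← aeval_linPoly, h.aeval_eq_zero_iff]
  simp

theorem isIntegral_coord (h : IsCurveGenericPoint T l₀ l₁ ξ) (i : σ) :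
    IsIntegral (Algebra.adjoin ℂ {linEval l₁ ξ}) (ξ i) := by
  have := isIntegral_coord_of_no_common_zero ξ T h.hom (fun G hG => h.aeval_mem hG)
    (linPoly l₀) (linPoly l₁) (isHomogeneous_linPoly _) (isHomogeneous_linPoly _)
    (by rw [aeval_linPoly, h.linEval_one]) (by simpa using h.eq_zero) i
  rwa [aeval_linPoly] at this

theorem exists_monic_eval₂_eq_zero (h : IsCurveGenericPoint T l₀ l₁ ξ) (i : σ) :
    ∃ P : Polynomial (Polynomial ℂ), P.Monic ∧ ∀ v ∈ affinePart T l₀,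
      (P.map (Polynomial.evalRingHom (l₁ v))).eval (v i) = 0 := by
  obtain ⟨Q, hQ, hQe⟩ := h.isIntegral_coord i
  let f : Polynomial ℂ →+* Algebra.adjoin ℂ {linEval l₁ ξ} :=
    ((Polynomial.aeval (linEval l₁ ξ) : Polynomial ℂ →ₐ[ℂ] Ω) : Polynomial ℂ →+* Ω).codRestrict
      (Algebra.adjoin ℂ {linEval l₁ ξ}).toSubring fun P =>
        Polynomial.aeval_mem_adjoin_singleton ℂ _
  have hf : Function.Surjective f := by
    rintro ⟨w, hw⟩
    rw [Algebra.adjoin_singleton_eq_range_aeval] at hw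
    obtain ⟨P, rfl⟩ := hw
    exact ⟨P, rfl⟩
  obtain ⟨P, hPQ, -, hP⟩ := Polynomial.lifts_and_natDegree_eq_and_monic
    ((Polynomial.mem_lifts Q).2 (Polynomial.map_surjective f hf Q)) hQ
  refine ⟨P, hP, fun v hv => ?_⟩
  let g : Polynomial ℂ →+* MvPolynomial σ ℂ :=
    (Polynomial.aeval (linPoly l₁) : Polynomial ℂ →ₐ[ℂ] MvPolynomial σ ℂ)
  have hz : MvPolynomial.aeval ξ (P.eval₂ g (MvPolynomial.X i)) = 0 := by
    rw [← hPQ, Polynomial.eval₂_map] at hQe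
    rw [← AlgHom.coe_toRingHom, Polynomial.hom_eval₂, ← hQe]
    congr 1
    · refine Polynomial.ringHom_ext (fun a => ?_) ?_
      · simp only [g, RingHom.comp_apply, RingHom.coe_coe, Polynomial.aeval_C, AlgHom.commutes]
        exact (Polynomial.aeval_C _ _).symm
      · simp only [g, RingHom.comp_apply, RingHom.coe_coe, Polynomial.aeval_X, aeval_linPoly]
        exact (Polynomial.aeval_X _).symm
    · simp
  have := (h.aeval_eq_zero_iff _).1 hz v hv
  rw [Polynomial.hom_eval₂] at this
  rw [Polynomial.eval_map, ← this]
  congr 1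
  · refine Polynomial.ringHom_ext (fun a => ?_) ?_ <;> simp [g]
  · simp

theorem finite_fiber (h : IsCurveGenericPoint T l₀ l₁ ξ) (τ : ℂ) :
    {v ∈ affinePart T l₀ | l₁ v = τ}.Finite := by
  choose P hP hPz using h.exists_monic_eval₂_eq_zero
  refine (Set.Finite.pi' fun i => ((P i).map (Polynomial.evalRingHom τ)).roots.toFinset.finite_toSet).subset ?_
  rintro v ⟨hv, rfl⟩ i
  simpa [((hP i).map (Polynomial.evalRingHom (l₁ v))).ne_zero] using hPz i v hv

theorem linEval_not_mem_range (h : IsCurveGenericPoint T l₀ l₁ ξ) :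
    linEval l₁ ξ ∉ Set.range (algebraMap ℂ Ω) := by
  rintro ⟨z, hz⟩
  refine h.infinite ((h.finite_fiber z).subset fun v hv => ⟨hv, ?_⟩)
  have := (h.aeval_eq_zero_iff (linPoly l₁ - MvPolynomial.C z)).1
    (by simp [aeval_linPoly, ← hz]) v hv
  simpa [sub_eq_zero] using this

theorem isAlgebraic_adjoin_linEval (h : IsCurveGenericPoint T l₀ l₁ ξ) :
    Algebra.IsAlgebraic (Algebra.adjoin ℂ {linEval l₁ ξ}) Ω := by
  have hle : Algebra.adjoin ℂ {linEval l₁ ξ} ≤ Algebra.adjoin ℂ (Set.range ξ) := by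
    refine Algebra.adjoin_le (Set.singleton_subset_iff.2 (Subalgebra.sum_mem _ fun i _ => ?_))
    exact Subalgebra.smul_mem _ (Algebra.subset_adjoin (Set.mem_range_self i)) _
  have h_int : Algebra.adjoin ℂ (Set.range ξ) ≤
      (integralClosure (Algebra.adjoin ℂ {linEval l₁ ξ}) Ω).restrictScalars ℂ :=
    Algebra.adjoin_le (Set.range_subset_iff.2 h.isIntegral_coord)
  have := h.isAlgebraic
  exact isAlgebraic_of_le_of_isIntegral hle fun x hx => h_int hx

/-- A polynomial which does not vanish at the generic point has finitely many zeros on the curve. -/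
theorem finite_zeros (h : IsCurveGenericPoint T l₀ l₁ ξ) {H : MvPolynomial σ ℂ}
    (hH : MvPolynomial.aeval ξ H ≠ 0) : {v ∈ affinePart T l₀ | MvPolynomial.eval v H = 0}.Finite := by
  have := h.isAlgebraic_adjoin_linEval
  obtain ⟨q, hq0, hq⟩ := (Algebra.IsAlgebraic.isAlgebraic (R := Algebra.adjoin ℂ {linEval l₁ ξ})
    (MvPolynomial.aeval ξ H)).exists_nonzero_coeff_and_aeval_eq_zero
      (mem_nonZeroDivisors_of_ne_zero hH)
  have hlift : ∀ x ∈ Algebra.adjoin ℂ {linEval l₁ ξ}, ∃ P : Polynomial ℂ,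
      x = MvPolynomial.aeval ξ (Polynomial.aeval (linPoly l₁) P) := by
    intro x hx
    rw [Algebra.adjoin_singleton_eq_range_aeval] at hx
    obtain ⟨P, rfl⟩ := hx
    exact ⟨P, by rw [← Polynomial.aeval_algHom_apply, aeval_linPoly]; rfl⟩
  obtain ⟨c, hc⟩ := hlift _ (q.coeff 0).2
  obtain ⟨Q, hQ⟩ : ∃ Q : MvPolynomial σ ℂ,
      MvPolynomial.aeval ξ Q = Polynomial.aeval (MvPolynomial.aeval ξ H) q.divX := by
    rw [Polynomial.aeval_eq_sum_range]
    choose! P hP using hlift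
    refine ⟨∑ k ∈ Finset.range (q.divX.natDegree + 1),
      Polynomial.aeval (linPoly l₁) (P (q.divX.coeff k)) * H ^ k, ?_⟩
    rw [map_sum]
    refine Finset.sum_congr rfl fun k _ => ?_
    rw [map_mul, map_pow, ← hP _ (q.divX.coeff k).2]
    rfl
  have hc0 : c ≠ 0 := by
    rintro rfl
    exact hq0 (Subtype.ext (by simpa using hc))
  have hrel : MvPolynomial.aeval ξ (Q * H + Polynomial.aeval (linPoly l₁) c) = 0 := by
    rw [map_add, map_mul, ← hc, hQ]
    rw [← Polynomial.divX_mul_X_add q] at hq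
    simpa using hq
  refine ((c.roots.toFinset.finite_toSet).biUnion fun τ _ => h.finite_fiber τ).subset ?_
  rintro v ⟨hv, hvH⟩
  have hv0 := (h.aeval_eq_zero_iff _).1 hrel v hv
  rw [map_add, map_mul, hvH, mul_zero, zero_add, ← MvPolynomial.coe_aeval_eq_eval,
    RingHom.coe_coe, ← Polynomial.aeval_algHom_apply, aeval_linPoly, linEval_complex] at hv0
  refine Set.mem_biUnion (x := l₁ v) ?_ ⟨hv, rfl⟩
  simpa [hc0] using hv0

end IsCurveGenericPoint

theorem exists_algHom_range {S Ω : Type*} [CommRing S] [Algebra ℂ S] [CommRing Ω] [Algebra ℂ Ω]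
    (f : S →ₐ[ℂ] Ω) (g : S →ₐ[ℂ] ℂ) (h : ∀ x, f x = 0 → g x = 0) :
    ∃ φ : f.range →ₐ[ℂ] ℂ, ∀ x, φ ⟨f x, x, rfl⟩ = g x := by
  let F := f.rangeRestrict
  have hF : Function.Surjective F := f.rangeRestrict_surjective
  have hker : RingHom.ker F = RingHom.ker f := by
    ext x
    exact Subtype.ext_iff
  have hle : ∀ a, a ∈ RingHom.ker F → g a = 0 := fun a ha => h a (by rwa [hker] at ha)
  let e := Ideal.quotientKerAlgEquivOfSurjective hF
  refine ⟨(Ideal.Quotient.liftₐ (RingHom.ker F) g hle).comp e.symm.toAlgHom, fun x => ?_⟩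
  have : e.symm ⟨f x, x, rfl⟩ = Ideal.Quotient.mk _ x := by
    rw [AlgEquiv.symm_apply_eq]
    rfl
  change Ideal.Quotient.liftₐ (RingHom.ker F) g hle (e.symm ⟨f x, x, rfl⟩) = g x
  rw [this]
  rfl

/-- A nonzero polynomial over a subfield of an algebraically closed field without nonzero roots
divides a power of `X`. -/
theorem Polynomial.exists_dvd_X_pow {K Ω : Type*} [Field K] [Field Ω] [IsAlgClosed Ω] [Algebra K Ω]
    (g : Polynomial K) (hg : ∀ β : Ω, Polynomial.aeval β g = 0 → β = 0) :
    ∃ k, g ∣ Polynomial.X ^ k := by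
  have hg0 : g ≠ 0 := by
    rintro rfl
    exact one_ne_zero (hg 1 (by simp))
  obtain ⟨q, hq, hq0⟩ := Polynomial.exists_eq_pow_rootMultiplicity_mul_and_not_dvd g hg0 0
  rw [Polynomial.C_0, sub_zero] at hq hq0
  have hdeg : q.degree = 0 := by
    by_contra hd
    obtain ⟨β, hβ⟩ := IsAlgClosed.exists_aeval_eq_zero Ω q hd
    have hβ0 : β = 0 := hg β (by rw [hq, map_mul, hβ, mul_zero])
    refine hq0 (Polynomial.X_dvd_iff.2 ?_)
    rw [hβ0] at hβ
    simpa [Polynomial.aeval_def, Polynomial.eval₂_at_zero] using hβ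
  refine ⟨g.rootMultiplicity 0, ?_⟩
  conv_lhs => rw [hq]
  exact (associated_mul_unit_left _ _ (Polynomial.isUnit_iff_degree_eq_zero.2 hdeg)).dvd

/-- An ideal of `A[X]` without nonzero root in an algebraically closed extension contains a nonzero
multiple of a power of `X`. -/
theorem Polynomial.exists_X_pow_mul_C_mem {A Ω : Type*} [CommRing A] [IsDomain A] [Field Ω]
    [IsAlgClosed Ω] [Algebra A Ω] [FaithfulSMul A Ω] (I : Ideal (Polynomial A))
    (hI : ∀ β : Ω, (∀ q ∈ I, Polynomial.aeval β q = 0) → β = 0) :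
    ∃ (k : ℕ) (s : A), s ≠ 0 ∧ Polynomial.X ^ k * Polynomial.C s ∈ I := by
  let K := FractionRing A
  let := FractionRing.liftAlgebra A Ω
  have := FractionRing.isScalarTower_liftAlgebra A Ω
  let ι : Polynomial A →+* Polynomial K := Polynomial.mapRingHom (algebraMap A K)
  obtain ⟨g, hg⟩ := IsPrincipalIdealRing.principal (I.map ι)
  obtain ⟨k, hk⟩ := g.exists_dvd_X_pow (Ω := Ω) fun β hβ => hI β fun q hq => by
    have hmem : ι q ∈ I.map ι := Ideal.mem_map_of_mem _ hq
    rw [hg] at hmem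
    obtain ⟨r, hr⟩ := Ideal.mem_span_singleton.1 hmem
    have h1 : Polynomial.aeval β (ι q) = 0 := by rw [hr, map_mul, hβ, zero_mul]
    rw [← h1]
    exact (Polynomial.aeval_map_algebraMap K β q).symm
  have hXk : (Polynomial.X ^ k : Polynomial K) ∈ I.map ι := by
    rw [hg]
    exact Ideal.mem_span_singleton.2 hk
  let := Polynomial.algebra A K
  have := Polynomial.isLocalization (nonZeroDivisors A) K
  obtain ⟨⟨a, s⟩, has⟩ := (IsLocalization.mem_map_algebraMap_iff
    ((nonZeroDivisors A).map (Polynomial.C : A →+* Polynomial A)) (Polynomial K)).1 hXk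
  obtain ⟨H, hH0, hHs⟩ := s.2
  refine ⟨k, H, nonZeroDivisors.ne_zero hH0, ?_⟩
  have hinj : Function.Injective ι := Polynomial.map_injective _ (IsFractionRing.injective A K)
  have : Polynomial.X ^ k * Polynomial.C H = (a : Polynomial A) := by
    apply hinj
    rw [map_mul, map_pow]
    simp only [ι, Polynomial.coe_mapRingHom, Polynomial.map_X]
    refine Eq.trans ?_ has
    congr 1
    rw [← hHs]
    rfl
  rw [this]
  exact a.2

namespace IsCurveGenericPoint

variable {σ Ω : Type*} [Fintype σ] [Field Ω] [Algebra ℂ Ω] {T : Set (MvPolynomial σ ℂ)}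
  {l₀ l₁ : Module.Dual ℂ (σ → ℂ)} {ξ : σ → Ω}

/-- If for infinitely many points `v` of the curve the line `pv` meets the curve in a further point,
then so does the line through `p` and the generic point. -/
theorem exists_secant (h : IsCurveGenericPoint T l₀ l₁ ξ) [IsAlgClosed Ω] (p : σ → ℂ)
    (hinf : {v ∈ affinePart T l₀ |
      ∃ b : ℂ, b ≠ 0 ∧ ∀ G ∈ T, MvPolynomial.eval (p + b • v) G = 0}.Infinite) :
    ∃ β : Ω, β ≠ 0 ∧ ∀ G ∈ T,
      MvPolynomial.aeval (fun i => algebraMap ℂ Ω (p i) + β * ξ i) G = 0 := by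
  let f : MvPolynomial σ ℂ →ₐ[ℂ] Ω := MvPolynomial.aeval ξ
  let A := f.range
  let η : σ → A := fun i => ⟨f (MvPolynomial.X i), MvPolynomial.X i, rfl⟩
  let Q : MvPolynomial σ ℂ → Polynomial A := MvPolynomial.aeval fun i =>
    algebraMap ℂ (Polynomial A) (p i) + Polynomial.X * Polynomial.C (η i)
  let I : Ideal (Polynomial A) := Ideal.span (Q '' T)
  by_contra! hno
  obtain ⟨k, ⟨_, H, rfl⟩, hH0, hHI⟩ := Polynomial.exists_X_pow_mul_C_mem (Ω := Ω) I (by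
    intro β hβ
    by_contra hβ0
    obtain ⟨G, hGT, hG⟩ := hno β hβ0
    apply hG
    rw [← hβ (Q G) (Ideal.subset_span ⟨G, hGT, rfl⟩)]
    refine Eq.trans ?_ (MvPolynomial.comp_aeval_apply _
      (((Polynomial.aeval β : Polynomial A →ₐ[A] Ω)).restrictScalars ℂ) G).symm
    congr 2
    funext i
    rw [map_add, AlgHom.commutes]
    simp [η, f]
    exact mul_comm _ _)
  have hHξ : MvPolynomial.aeval ξ H ≠ 0 := fun h0 =>
    hH0 (Subtype.ext h0)
  refine hinf ((h.finite_zeros hHξ).subset ?_)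
  rintro v ⟨hv, b, hb, hbT⟩
  refine ⟨hv, ?_⟩
  obtain ⟨φ, hφ⟩ := exists_algHom_range f (MvPolynomial.aeval v)
    fun G hG => (h.aeval_eq_zero_iff G).1 hG v hv
  let ψ : Polynomial A →+* ℂ := Polynomial.eval₂RingHom (φ : A →+* ℂ) b
  have hψI : I ≤ RingHom.ker ψ := by
    refine Ideal.span_le.2 ?_
    rintro _ ⟨G, hG, rfl⟩
    let ψ' : Polynomial A →ₐ[ℂ] ℂ := { ψ with
      commutes' := fun z => by
        change Polynomial.eval₂ (φ : A →+* ℂ) b (Polynomial.C (algebraMap ℂ A z)) = _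
        rw [Polynomial.eval₂_C]
        exact φ.commutes z }
    change ψ' (Q G) = 0
    refine (MvPolynomial.comp_aeval_apply _ ψ' G).trans ?_
    rw [← hbT G hG, ← MvPolynomial.coe_aeval_eq_eval, RingHom.coe_coe]
    congr 2
    funext i
    rw [map_add, AlgHom.commutes, map_mul]
    have h1 : ψ' Polynomial.X = b := Polynomial.eval₂_X _ _
    have h2 : ψ' (Polynomial.C (η i)) = v i :=
      (Polynomial.eval₂_C _ _).trans ((hφ _).trans (MvPolynomial.aeval_X _ _))
    rw [h1, h2]
    rfl
  have h0 := hψI hHI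
  rw [RingHom.mem_ker, map_mul, map_pow] at h0
  have h1 : ψ Polynomial.X = b := Polynomial.eval₂_X _ _
  have h2 : ψ (Polynomial.C ⟨f.toRingHom H, H, rfl⟩) = MvPolynomial.eval v H :=
    (Polynomial.eval₂_C _ _).trans ((hφ _).trans rfl)
  rw [h1, h2] at h0
  exact (mul_eq_zero.1 h0).resolve_left (pow_ne_zero _ hb)

/-- First order jets of the curve, compatible with finitely many families of secants. -/
theorem exists_jet (h : IsCurveGenericPoint T l₀ l₁ ξ) (P : Finset (σ → ℂ))
    (hP : ∀ p ∈ P, ∃ β : Ω, β ≠ 0 ∧ ∀ G ∈ T,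
      MvPolynomial.aeval (fun i => algebraMap ℂ Ω (p i) + β * ξ i) G = 0) :
    ∃ x x' : σ → ℂ, x ∈ affinePart T l₀ ∧ l₀ x' = 0 ∧ l₁ x' = 1 ∧ ∀ p ∈ P, ∃ b b' : ℂ, b ≠ 0 ∧
      ∀ G ∈ T, MvPolynomial.eval (p + b • x) G = 0 ∧
        ∑ i, MvPolynomial.eval (p + b • x) (MvPolynomial.pderiv i G) *
          (b' • x + b • x') i = 0 := by
  have := h.isAlgebraic_adjoin_linEval
  obtain ⟨D, hD⟩ := exists_derivation_eq_one _ (transcendental_of_not_mem_range h.linEval_not_mem_range)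
  choose! β hβ0 hβ using hP
  obtain ⟨A, φ, hA⟩ := exists_specialization (s := Set.range ξ ∪ Set.range (fun i => D (ξ i)) ∪
    (β '' P ∪ (fun p => (β p)⁻¹) '' P ∪ (fun p => D (β p)) '' P))
    (((Set.finite_range _).union (Set.finite_range _)).union
      (((P.finite_toSet.image _).union (P.finite_toSet.image _)).union (P.finite_toSet.image _)))
  simp only [Set.union_subset_iff, Set.image_subset_iff, Set.range_subset_iff] at hA
  obtain ⟨⟨hξA, hDA⟩, ⟨hβA, hβiA⟩, hDβA⟩ := hA
  have hφ : ∀ (ζ : σ → A) (G : MvPolynomial σ ℂ),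
      MvPolynomial.aeval (fun i => (ζ i : Ω)) G = 0 → MvPolynomial.eval (fun i => φ (ζ i)) G = 0 := by
    intro ζ G hG
    have h1 : MvPolynomial.aeval ζ G = 0 := Subtype.val_injective
      ((MvPolynomial.comp_aeval_apply _ A.val G).trans hG)
    rw [← MvPolynomial.coe_aeval_eq_eval, RingHom.coe_coe, ← MvPolynomial.comp_aeval_apply, h1,
      map_zero]
  have hDlin : ∀ l : Module.Dual ℂ (σ → ℂ), D (linEval l ξ) = linEval l fun i => D (ξ i) := by
    intro l
    simp [linEval]
  have hφlin : ∀ (l : Module.Dual ℂ (σ → ℂ)) (ζ : σ → A) (z : ℂ),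
      linEval l (fun i => (ζ i : Ω)) = algebraMap ℂ Ω z → l (fun i => φ (ζ i)) = z := by
    intro l ζ z hz
    have h1 := hφ ζ (linPoly l - MvPolynomial.C z) (by rw [map_sub, aeval_linPoly, hz]; simp)
    simpa [sub_eq_zero] using h1
  let x : σ → ℂ := fun i => φ ⟨ξ i, hξA i⟩
  let x' : σ → ℂ := fun i => φ ⟨D (ξ i), hDA i⟩
  refine ⟨x, x', ⟨?_, fun G hG => hφ _ G (h.aeval_mem hG)⟩, ?_, ?_, fun p hp => ?_⟩
  · exact hφlin l₀ (fun i => ⟨ξ i, hξA i⟩) 1 (by rw [map_one]; exact h.linEval_one)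
  · refine hφlin l₀ (fun i => ⟨D (ξ i), hDA i⟩) 0 ?_
    rw [map_zero]
    refine (hDlin l₀).symm.trans ?_
    rw [h.linEval_one, D.map_one_eq_zero]
  · refine hφlin l₁ (fun i => ⟨D (ξ i), hDA i⟩) 1 ?_
    rw [map_one]
    exact (hDlin l₁).symm.trans hD
  · let B : A := ⟨β p, hβA hp⟩
    let B' : A := ⟨D (β p), hDβA hp⟩
    let ζ : σ → A := fun i => algebraMap ℂ A (p i) + B * ⟨ξ i, hξA i⟩
    have hζ : (fun i => φ (ζ i)) = p + φ B • x := by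
      funext i
      simp [ζ, x]
    refine ⟨φ B, φ B', ?_, fun G hG => ⟨?_, ?_⟩⟩
    · have : B * ⟨(β p)⁻¹, hβiA hp⟩ = 1 := Subtype.ext (mul_inv_cancel₀ (hβ0 p hp))
      exact left_ne_zero_of_mul_eq_one (by rw [← map_mul, this, map_one])
    · rw [← hζ]
      exact hφ ζ G (hβ p hp G hG)
    · have h1 : ∑ i, MvPolynomial.aeval ζ (MvPolynomial.pderiv i G) *
          (B' * ⟨ξ i, hξA i⟩ + B * ⟨D (ξ i), hDA i⟩) = 0 := by
        apply Subtype.val_injective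
        have h2 := D.map_mvPolynomial_aeval (fun i => (ζ i : Ω)) G
        rw [show MvPolynomial.aeval (fun i => (ζ i : Ω)) G = 0 from hβ p hp G hG, map_zero] at h2
        change A.val _ = 0
        rw [h2, map_sum]
        refine Finset.sum_congr rfl fun i _ => ?_
        rw [map_mul, MvPolynomial.comp_aeval_apply]
        congr 1
        change D (β p) * ξ i + β p * D (ξ i) = D (algebraMap ℂ Ω (p i) + β p * ξ i)
        rw [map_add, D.map_algebraMap, D.leibniz, zero_add, smul_eq_mul, smul_eq_mul]
        ring
      have h2 := congrArg φ h1
      rw [map_sum, map_zero] at h2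
      rw [← h2]
      refine Finset.sum_congr rfl fun i _ => ?_
      rw [map_mul, MvPolynomial.comp_aeval_apply, hζ, map_add, map_mul, map_mul]
      rfl

end IsCurveGenericPoint

theorem Polynomial.aevalAeval_eq_eval₂ {A : Type*} [CommRing A] [Algebra ℂ A] (x y : A)
    (F : Polynomial (Polynomial ℂ)) : Polynomial.aevalAeval x y F =
      F.eval₂ ((Polynomial.aeval x : Polynomial ℂ →ₐ[ℂ] A) : Polynomial ℂ →+* A) y := by
  induction F using Polynomial.induction_on' with
  | add p q hp hq => rw [map_add, Polynomial.eval₂_add, hp, hq]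
  | monomial k a =>
    rw [← Polynomial.C_mul_X_pow_eq_monomial, map_mul, map_pow, Polynomial.aevalAeval_C,
      Polynomial.aevalAeval_Y]
    simp

theorem Polynomial.coeff_coeff_swap (F : Polynomial (Polynomial ℂ)) (i j : ℕ) :
    ((Polynomial.Bivariate.swap F).coeff i).coeff j = (F.coeff j).coeff i := by
  induction F using Polynomial.induction_on' with
  | add p q hp hq => simp only [map_add, Polynomial.coeff_add, hp, hq]
  | monomial k a =>
    induction a using Polynomial.induction_on' with
    | add p q hp hq => simp only [map_add, Polynomial.coeff_add, hp, hq]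
    | monomial m r =>
      rw [Polynomial.Bivariate.swap_monomial_monomial]
      simp only [Polynomial.coeff_monomial]
      split_ifs <;> simp_all [Polynomial.coeff_monomial]

theorem Polynomial.natDegree_coeff_le_swap (F : Polynomial (Polynomial ℂ)) (j : ℕ) :
    (F.coeff j).natDegree ≤ (Polynomial.Bivariate.swap F).natDegree := by
  refine Polynomial.natDegree_le_iff_coeff_eq_zero.2 fun i hi => ?_
  rw [← Polynomial.coeff_coeff_swap, Polynomial.coeff_eq_zero_of_natDegree_lt hi,
    Polynomial.coeff_zero]

theorem Polynomial.separable_map_fractionRing {F : Polynomial (Polynomial ℂ)} (hF : Irreducible F)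
    (hdeg : F.natDegree ≠ 0) :
    Irreducible (F.map (algebraMap (Polynomial ℂ) (FractionRing (Polynomial ℂ)))) ∧
      (F.map (algebraMap (Polynomial ℂ) (FractionRing (Polynomial ℂ)))).Separable := by
  have hirr := ((hF.isPrimitive hdeg).irreducible_iff_irreducible_map_fraction_map
    (K := FractionRing (Polynomial ℂ))).1 hF
  have : CharZero (FractionRing (Polynomial ℂ)) := charZero_of_injective_algebraMap
    (IsFractionRing.injective (Polynomial ℂ) _)
  exact ⟨hirr, hirr.separable⟩

/-- The conjugates over `ℂ(u)` of a root of an irreducible polynomial. -/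
theorem exists_conjugates {Ω : Type*} [Field Ω] [Algebra ℂ Ω] [IsAlgClosed Ω] {u v : Ω}
    (hu : Transcendental ℂ u) [Algebra.IsAlgebraic (Algebra.adjoin ℂ {u}) Ω]
    {F : Polynomial (Polynomial ℂ)} (hF : Irreducible F)
    (hFuv : Polynomial.aevalAeval u v F = 0) (hdeg : F.natDegree ≠ 0) :
    ∃ s : Finset Ω, s.card = F.natDegree ∧ ∀ w ∈ s, ∃ τ : Ω →ₐ[ℂ] Ω, τ u = u ∧ τ v = w := by
  let : Algebra (Polynomial ℂ) Ω := (Polynomial.aeval u : Polynomial ℂ →ₐ[ℂ] Ω).toAlgebra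
  have : FaithfulSMul (Polynomial ℂ) Ω := (faithfulSMul_iff_algebraMap_injective _ _).2
    (transcendental_iff_injective.1 hu)
  have : Algebra.IsAlgebraic (Polynomial ℂ) Ω := isAlgebraic_polynomial_of_adjoin u rfl
  let K := FractionRing (Polynomial ℂ)
  let := FractionRing.liftAlgebra (Polynomial ℂ) Ω
  have := FractionRing.isScalarTower_liftAlgebra (Polynomial ℂ) Ω
  have : Algebra.IsAlgebraic K Ω :=
    .extendScalars (IsFractionRing.injective (Polynomial ℂ) _)
  have : IsAlgClosure K Ω := ⟨inferInstance, inferInstance⟩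
  have : Normal K Ω := IsAlgClosure.normal K Ω
  obtain ⟨hirr, hsep⟩ := Polynomial.separable_map_fractionRing hF hdeg
  have hv : Polynomial.aeval v (F.map (algebraMap (Polynomial ℂ) K)) = 0 := by
    rw [Polynomial.aeval_map_algebraMap, Polynomial.aeval_def, ← hFuv,
      Polynomial.aevalAeval_eq_eval₂]
    rfl
  have hmin := minpoly.eq_of_irreducible hirr hv
  refine ⟨((F.map (algebraMap (Polynomial ℂ) K)).rootSet Ω).toFinset, ?_, fun w hw => ?_⟩
  · rw [Set.toFinset_card, Polynomial.card_rootSet_eq_natDegree hsep (IsAlgClosed.splits _),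
      Polynomial.natDegree_map_eq_of_injective (IsFractionRing.injective (Polynomial ℂ) _)]
  · rw [Set.mem_toFinset, Polynomial.mem_rootSet] at hw
    obtain ⟨τ, hτ⟩ := minpoly.exists_algEquiv_of_root' (K := K) (x := w) (y := v)
      (Algebra.IsAlgebraic.isAlgebraic v) (by rw [← hmin, map_mul, hw.2, zero_mul])
    have hfix : ∀ P : Polynomial ℂ, τ (Polynomial.aeval u P) = Polynomial.aeval u P := by
      intro P
      have : algebraMap K Ω (algebraMap _ K P) = Polynomial.aeval u P :=
        (IsScalarTower.algebraMap_apply (Polynomial ℂ) K Ω P).symm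
      rw [← this, τ.commutes]
    refine ⟨{ (τ : Ω →+* Ω) with commutes' := fun z => ?_ }, ?_, hτ⟩
    · simpa using hfix (Polynomial.C z)
    · simpa using hfix Polynomial.X

theorem linEval_sub_smul {σ A : Type*} [Fintype σ] [CommRing A] [Algebra ℂ A]
    (a b : Module.Dual ℂ (σ → ℂ)) (c : ℂ) (ξ : σ → A) :
    linEval (a - c • b) ξ = linEval a ξ - algebraMap ℂ A c * linEval b ξ := by
  simp only [linEval, Finset.mul_sum, Algebra.smul_def, LinearMap.sub_apply,
    LinearMap.smul_apply, map_sub, map_mul, Algebra.algebraMap_self, RingHom.id_apply]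
  rw [← Finset.sum_sub_distrib]
  exact Finset.sum_congr rfl fun i _ => by ring

namespace IsCurveGenericPoint

variable {σ Ω : Type*} [Fintype σ] [Field Ω] [Algebra ℂ Ω] {T : Set (MvPolynomial σ ℂ)}
  {l₀ l₁ : Module.Dual ℂ (σ → ℂ)} {ξ : σ → Ω}

theorem isAlgebraic_adjoin (h : IsCurveGenericPoint T l₀ l₁ ξ) {u : Ω}
    (hu : u ∉ Set.range (algebraMap ℂ Ω)) : Algebra.IsAlgebraic (Algebra.adjoin ℂ {u}) Ω := by
  have := h.isAlgebraic_adjoin_linEval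
  exact isAlgebraic_adjoin_of_not_mem_range (linEval l₁ ξ) u hu

/-- The degree of an equation for `y / b` over `ℂ(a / b)` is at most the size of a hyperplane
section of the curve. -/
theorem natDegree_le (h : IsCurveGenericPoint T l₀ l₁ ξ) [IsAlgClosed Ω] {e : ℕ}
    (he : ∀ l : Module.Dual ℂ (σ → ℂ), linEval l ξ ≠ 0 →
      {v ∈ affinePart T l₀ | l v = 0}.Finite ∧ {v ∈ affinePart T l₀ | l v = 0}.ncard ≤ e)
    {a b y : Module.Dual ℂ (σ → ℂ)} (hb : linEval b ξ ≠ 0)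
    (hu : linEval a ξ / linEval b ξ ∉ Set.range (algebraMap ℂ Ω))
    {F : Polynomial (Polynomial ℂ)} (hF : Irreducible F)
    (hFuv : Polynomial.aevalAeval (linEval a ξ / linEval b ξ) (linEval y ξ / linEval b ξ) F = 0) :
    F.natDegree ≤ e := by
  by_cases hdeg : F.natDegree = 0
  · simp [hdeg]
  have := h.isAlgebraic_adjoin hu
  obtain ⟨s, hs, hτ⟩ := exists_conjugates (transcendental_of_not_mem_range hu) hF hFuv hdeg
  set u := linEval a ξ / linEval b ξ with hudef
  set v := linEval y ξ / linEval b ξ with hvdef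
  choose! τ hτu hτv using hτ
  obtain ⟨A, φ, hA⟩ := exists_specialization (s := {u} ∪ (⋃ w ∈ s, Set.range fun i => τ w (ξ i)) ∪
      (fun w => (τ w (linEval b ξ))⁻¹) '' s ∪ (s : Set Ω) ∪
      (fun w : Ω × Ω => (w.1 - w.2)⁻¹) '' (s ×ˢ s))
    (((((Set.finite_singleton u).union (s.finite_toSet.biUnion fun w _ => Set.finite_range _)).union
      (s.finite_toSet.image _)).union s.finite_toSet).union
      ((s.finite_toSet.prod s.finite_toSet).image _))
  simp only [Set.union_subset_iff, Set.image_subset_iff, Set.singleton_subset_iff,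
    Set.iUnion_subset_iff, Set.range_subset_iff] at hA
  obtain ⟨⟨⟨⟨huA, hξA⟩, hbA⟩, hsA⟩, hdA⟩ := hA
  have hφ : ∀ (ζ : σ → A) (G : MvPolynomial σ ℂ),
      MvPolynomial.aeval (fun i => (ζ i : Ω)) G = 0 → MvPolynomial.eval (fun i => φ (ζ i)) G = 0 := by
    intro ζ G hG
    have h1 : MvPolynomial.aeval ζ G = 0 := Subtype.val_injective
      ((MvPolynomial.comp_aeval_apply _ A.val G).trans hG)
    rw [← MvPolynomial.coe_aeval_eq_eval, RingHom.coe_coe, ← MvPolynomial.comp_aeval_apply, h1,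
      map_zero]
  let ζ : Ω → σ → A := fun w i => if hw : w ∈ s then ⟨τ w (ξ i), hξA w hw i⟩ else 0
  have hζ : ∀ w ∈ s, ∀ i, (ζ w i : Ω) = τ w (ξ i) := fun w hw i => by simp [ζ, hw]
  let x : Ω → σ → ℂ := fun w i => φ (ζ w i)
  have hxl : ∀ (l : Module.Dual ℂ (σ → ℂ)) (w : Ω), φ (linEval l (ζ w)) = l (x w) := by
    intro l w
    rw [← linEval_complex]
    simp [linEval, x]
  have hval : ∀ w ∈ s, ∀ l : Module.Dual ℂ (σ → ℂ),
      ((linEval l (ζ w) : A) : Ω) = τ w (linEval l ξ) := by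
    intro w hw l
    simp [linEval, hζ w hw]
  have hxb : ∀ w ∈ s, b (x w) ≠ 0 := by
    intro w hw
    have : linEval b (ζ w) * ⟨(τ w (linEval b ξ))⁻¹, hbA hw⟩ = 1 := Subtype.ext (by
      change ((linEval b (ζ w) : A) : Ω) * (τ w (linEval b ξ))⁻¹ = 1
      rw [hval w hw, mul_inv_cancel₀]
      simpa using hb)
    rw [← hxl]
    exact left_ne_zero_of_mul_eq_one (by rw [← map_mul, this, map_one])
  have hxa : ∀ w ∈ s, a (x w) = φ ⟨u, huA⟩ * b (x w) := by
    intro w hw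
    rw [← hxl, ← hxl, ← map_mul]
    congr 1
    apply Subtype.ext
    change ((linEval a (ζ w) : A) : Ω) = u * ((linEval b (ζ w) : A) : Ω)
    rw [hval w hw, hval w hw]
    conv_rhs => rw [← hτu w hw]
    rw [← map_mul, hudef, div_mul_cancel₀ _ hb]
  have hxy : ∀ (w : Ω) (hw : w ∈ s), y (x w) = φ ⟨w, hsA hw⟩ * b (x w) := by
    intro w hw
    rw [← hxl, ← hxl, ← map_mul]
    congr 1
    apply Subtype.ext
    change ((linEval y (ζ w) : A) : Ω) = w * ((linEval b (ζ w) : A) : Ω)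
    rw [hval w hw, hval w hw]
    conv_rhs => enter [1]; rw [← hτv w hw]
    rw [← map_mul, hvdef, div_mul_cancel₀ _ hb]
  have hinj : Set.InjOn x s := by
    intro w hw w' hw' hww
    by_contra hne
    have h1 := hxy w hw
    rw [hww, hxy w' hw'] at h1
    have h2 : φ ⟨w', hsA hw'⟩ = φ ⟨w, hsA hw⟩ := mul_right_cancel₀ (hxb w' hw') h1
    have h3 : ((⟨w, hsA hw⟩ : A) - ⟨w', hsA hw'⟩) * ⟨(w - w')⁻¹, hdA (Set.mk_mem_prod hw hw')⟩ = 1 :=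
      Subtype.ext (mul_inv_cancel₀ (sub_ne_zero.2 hne))
    have h4 := congrArg φ h3
    rw [map_mul, map_sub, h2, sub_self, zero_mul, map_one] at h4
    exact zero_ne_one h4
  obtain ⟨hfin, hcard⟩ := he (a - φ ⟨u, huA⟩ • b) (fun h0 => hu ⟨φ ⟨u, huA⟩, by
    rw [linEval_sub_smul] at h0
    exact ((div_eq_iff hb).2 (sub_eq_zero.1 h0)).symm⟩)
  rw [← hs, ← Finset.card_image_of_injOn hinj, ← Set.ncard_coe_finset]
  refine (Set.ncard_le_ncard ?_ hfin).trans hcard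
  intro z hz
  rw [Finset.coe_image] at hz
  obtain ⟨w, hw, rfl⟩ := hz
  have hvan : ∀ G, MvPolynomial.aeval ξ G = 0 → MvPolynomial.eval (x w) G = 0 := by
    intro G hG
    refine hφ (ζ w) G ?_
    simp only [hζ w hw]
    rw [← MvPolynomial.comp_aeval_apply, hG, map_zero]
  refine ⟨⟨?_, fun G hG => hvan G (h.aeval_mem hG)⟩, ?_⟩
  · have := hvan (linPoly l₀ - 1) (by rw [map_sub, map_one, aeval_linPoly, h.linEval_one, sub_self])
    simpa [sub_eq_zero] using this
  · simp [hxa w hw]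

end IsCurveGenericPoint

theorem Polynomial.natDegree_det_le {ι R : Type*} [Fintype ι] [DecidableEq ι] [CommRing R]
    (M : Matrix ι ι (Polynomial R)) {k : ℕ} (hM : ∀ i j, (M i j).natDegree ≤ k) :
    M.det.natDegree ≤ Fintype.card ι * k := by
  rw [Matrix.det_apply]
  refine Polynomial.natDegree_sum_le_of_forall_le _ _ fun τ _ => ?_
  rw [Units.smul_def]
  refine (Polynomial.natDegree_smul_le _ _).trans ((Polynomial.natDegree_prod_le _ _).trans ?_)
  exact (Finset.sum_le_sum fun i _ => hM _ _).trans (by simp)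

/-- The discriminant of an irreducible plane curve: a polynomial vanishing at every `u` for which
the equation has a multiple root. -/
theorem Polynomial.exists_discriminant {F : Polynomial (Polynomial ℂ)} (hF : Irreducible F)
    (hdeg : F.natDegree ≠ 0) {e : ℕ} (hle : F.natDegree ≤ e)
    (hle' : (Polynomial.Bivariate.swap F).natDegree ≤ e) :
    ∃ r : Polynomial ℂ, r ≠ 0 ∧ r.natDegree ≤ 2 * e * e ∧ ∀ u v : ℂ,
      (F.map (Polynomial.evalRingHom u)).IsRoot v →
      (Polynomial.derivative (F.map (Polynomial.evalRingHom u))).IsRoot v → r.IsRoot u := by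
  have hsep := (Polynomial.separable_map_fractionRing hF hdeg).2
  have hinj := IsFractionRing.injective (Polynomial ℂ) (FractionRing (Polynomial ℂ))
  have hcoeff : ∀ k, (F.coeff k).natDegree ≤ e := fun k =>
    (Polynomial.natDegree_coeff_le_swap F k).trans hle'
  have hcoeff' : ∀ k, ((Polynomial.derivative F).coeff k).natDegree ≤ e := fun k => by
    rw [Polynomial.coeff_derivative, ← Nat.cast_succ]
    exact (Polynomial.natDegree_mul_le).trans (by rw [Polynomial.natDegree_natCast]; exact hcoeff (k + 1))
  refine ⟨Polynomial.resultant F (Polynomial.derivative F), ?_, ?_, ?_⟩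
  · have h1 := Polynomial.resultant_ne_zero _ _ hsep
    rw [Polynomial.derivative_map, Polynomial.natDegree_map_eq_of_injective hinj,
      Polynomial.natDegree_map_eq_of_injective hinj, Polynomial.resultant_map_map] at h1
    exact fun h0 => h1 (by rw [h0, map_zero])
  · refine (Polynomial.natDegree_det_le _ (k := e) fun i j => ?_).trans ?_
    · induction j using Fin.addCases <;> simp only [Polynomial.sylvester, Matrix.of_apply,
        Fin.addCases_left, Fin.addCases_right] <;> split_ifs <;> simp [hcoeff, hcoeff']
    · rw [Fintype.card_fin]
      gcongr
      have := Polynomial.natDegree_derivative_le F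
      omega
  · intro u v hu hv
    obtain ⟨p, q, -, -, hpq⟩ := Polynomial.exists_mul_add_mul_eq_C_resultant F
      (Polynomial.derivative F) le_rfl le_rfl (Or.inl hdeg)
    have := congrArg (fun Q => (Q.map (Polynomial.evalRingHom u)).eval v) hpq
    simp only [Polynomial.map_add, Polynomial.map_mul, Polynomial.eval_add, Polynomial.eval_mul,
      ← Polynomial.derivative_map, hu.eq_zero, hv.eq_zero, zero_mul, add_zero] at this
    simpa using this.symm

theorem exists_irreducible_aevalAeval_eq_zero {Ω : Type*} [Field Ω] [Algebra ℂ Ω] {u : Ω}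
    [Algebra.IsAlgebraic (Algebra.adjoin ℂ {u}) Ω] (v : Ω) :
    ∃ F : Polynomial (Polynomial ℂ), Irreducible F ∧ Polynomial.aevalAeval u v F = 0 := by
  let : Algebra (Polynomial ℂ) Ω := (Polynomial.aeval u : Polynomial ℂ →ₐ[ℂ] Ω).toAlgebra
  have : Algebra.IsAlgebraic (Polynomial ℂ) Ω := isAlgebraic_polynomial_of_adjoin u rfl
  obtain ⟨P, hP, hPv⟩ := Algebra.IsAlgebraic.isAlgebraic (R := Polynomial ℂ) v
  have hPuv : Polynomial.aevalAeval u v P = 0 := by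
    rw [Polynomial.aevalAeval_eq_eval₂, ← hPv]
    rfl
  obtain ⟨f, hf, c, hc⟩ := UniqueFactorizationMonoid.exists_prime_factors P hP
  rw [← hc, map_mul, map_multiset_prod] at hPuv
  have h0 := (mul_eq_zero.1 hPuv).resolve_right (c.isUnit.map _).ne_zero
  obtain ⟨F, hF, hF0⟩ := Multiset.mem_map.1 (Multiset.prod_eq_zero_iff.1 h0)
  exact ⟨F, (hf F hF).irreducible, hF0⟩

/-- The form of degree `2 * e` obtained from `F(a / b, y / b)` by clearing denominators. -/
def homogenizedForm {σ : Type*} [Fintype σ] (F : Polynomial (Polynomial ℂ)) (e : ℕ)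
    (a b y : Module.Dual ℂ (σ → ℂ)) : MvPolynomial σ ℂ :=
  ∑ j ∈ Finset.range (e + 1), ∑ i ∈ Finset.range (e + 1),
    MvPolynomial.C ((F.coeff j).coeff i) *
      (linPoly a ^ i * linPoly y ^ j * linPoly b ^ ((e - i) + (e - j)))

section homogenizedForm

variable {σ : Type*} [Fintype σ] {F : Polynomial (Polynomial ℂ)} {e : ℕ}
  {a b y : Module.Dual ℂ (σ → ℂ)}

theorem isHomogeneous_homogenizedForm : (homogenizedForm F e a b y).IsHomogeneous (2 * e) := by
  refine MvPolynomial.IsHomogeneous.sum _ _ _ fun j hj =>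
    MvPolynomial.IsHomogeneous.sum _ _ _ fun i hi => ?_
  rw [Finset.mem_range] at hi hj
  convert (MvPolynomial.isHomogeneous_C σ _).mul ((((isHomogeneous_linPoly a).pow i).mul
    ((isHomogeneous_linPoly y).pow j)).mul ((isHomogeneous_linPoly b).pow _)) using 1
  omega

theorem aeval_homogenizedForm {A : Type*} [CommRing A] [Algebra ℂ A] {ζ : σ → A} {ν : A}
    (hν : linEval b ζ * ν = 1) (hle : F.natDegree ≤ e)
    (hle' : (Polynomial.Bivariate.swap F).natDegree ≤ e) :
    MvPolynomial.aeval ζ (homogenizedForm F e a b y) = linEval b ζ ^ (2 * e) *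
      Polynomial.aevalAeval (linEval a ζ * ν) (linEval y ζ * ν) F := by
  rw [Polynomial.aevalAeval_eq_eval₂, Polynomial.eval₂_eq_sum_range' _ (Nat.lt_succ_of_le hle),
    Finset.mul_sum]
  simp only [homogenizedForm, map_sum]
  refine Finset.sum_congr rfl fun j hj => ?_
  rw [RingHom.coe_coe, Polynomial.aeval_eq_sum_range'
    (Nat.lt_succ_of_le ((Polynomial.natDegree_coeff_le_swap F j).trans hle')), Finset.sum_mul,
    Finset.mul_sum]
  refine Finset.sum_congr rfl fun i hi => ?_
  rw [Finset.mem_range, Nat.lt_succ_iff] at hi hj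
  have hpow : ∀ k ≤ e, linEval b ζ ^ (e - k) = linEval b ζ ^ e * ν ^ k := by
    intro k hk
    conv_rhs => rw [← Nat.sub_add_cancel hk, pow_add, mul_assoc, ← mul_pow, hν, one_pow, mul_one]
  simp only [map_mul, map_pow, aeval_linPoly, MvPolynomial.algHom_C, Algebra.smul_def]
  rw [pow_add, hpow i hi, hpow j hj]
  ring

/-- If the form vanishes to second order along a direction on which `a` and `b` vanish and `y` does
not, then the corresponding plane equation has a multiple root. -/
theorem isRoot_of_homogenizedForm (hle : F.natDegree ≤ e)
    (hle' : (Polynomial.Bivariate.swap F).natDegree ≤ e) {z w : σ → ℂ} (hz : b z ≠ 0)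
    (haw : a w = 0) (hbw : b w = 0) (hyw : y w ≠ 0)
    (h0 : MvPolynomial.eval z (homogenizedForm F e a b y) = 0)
    (h1 : ∑ i, MvPolynomial.eval z (MvPolynomial.pderiv i (homogenizedForm F e a b y)) * w i = 0) :
    (F.map (Polynomial.evalRingHom (a z / b z))).IsRoot (y z / b z) ∧
      (Polynomial.derivative (F.map (Polynomial.evalRingHom (a z / b z)))).IsRoot (y z / b z) := by
  let ζ : σ → Polynomial ℂ := fun i => Polynomial.C (z i) + Polynomial.X * Polynomial.C (w i)
  have hlin : ∀ l : Module.Dual ℂ (σ → ℂ),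
      linEval l ζ = Polynomial.C (l z) + Polynomial.X * Polynomial.C (l w) := by
    intro l
    rw [← linEval_complex l z, ← linEval_complex l w]
    simp only [linEval, map_sum, Finset.mul_sum, ζ, Polynomial.smul_eq_C_mul,
      smul_eq_mul, map_mul]
    rw [← Finset.sum_add_distrib]
    exact Finset.sum_congr rfl fun i _ => by ring
  have hb : linEval b ζ = Polynomial.C (b z) := by simp [hlin, hbw]
  have ha : linEval a ζ = Polynomial.C (a z) := by simp [hlin, haw]
  have hG := aeval_homogenizedForm (F := F) (a := a) (y := y) (ζ := ζ)
    (ν := Polynomial.C (b z)⁻¹) (by rw [hb, ← Polynomial.C_mul, mul_inv_cancel₀ hz,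
      Polynomial.C_1]) hle hle'
  set q := F.map (Polynomial.evalRingHom (a z / b z)) with hq
  set t := linEval y ζ * Polynomial.C (b z)⁻¹ with ht
  have hcomp : Polynomial.aevalAeval (linEval a ζ * Polynomial.C (b z)⁻¹) t F = q.comp t := by
    rw [Polynomial.aevalAeval_eq_eval₂, hq, Polynomial.comp, Polynomial.eval₂_map, ha,
      ← Polynomial.C_mul, ← div_eq_mul_inv]
    congr 1
    refine Polynomial.ringHom_ext (fun c => ?_) ?_ <;> simp
  have ht0 : t.eval 0 = y z / b z := by simp [ht, hlin, div_eq_mul_inv]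
  have ht1 : (Polynomial.derivative t).eval 0 = y w / b z := by
    simp [ht, hlin, div_eq_mul_inv]
  rw [hcomp, hb, ← Polynomial.C_pow] at hG
  have hζ0 : ∀ G : MvPolynomial σ ℂ, (MvPolynomial.aeval ζ G).eval 0 = MvPolynomial.eval z G := by
    intro G
    rw [← Polynomial.coe_aeval_eq_eval, MvPolynomial.comp_aeval_apply,
      ← MvPolynomial.coe_aeval_eq_eval]
    simp [ζ]
  constructor
  · have := congrArg (Polynomial.eval 0) hG
    rw [hζ0, h0, Polynomial.eval_mul, Polynomial.eval_C, Polynomial.eval_comp, ht0] at this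
    simpa [hz] using this.symm
  · have hD := congrArg (fun Q => (Polynomial.derivative' Q).eval 0) hG
    simp only [Derivation.map_mvPolynomial_aeval] at hD
    simp only [Polynomial.eval_finsetSum, Polynomial.eval_mul, hζ0] at hD
    have hd : ∀ i, (Polynomial.derivative' (ζ i)).eval 0 = w i := by
      intro i
      change (Polynomial.derivative (ζ i)).eval 0 = w i
      simp [ζ]
    simp only [hd, h1] at hD
    change _ = (Polynomial.derivative _).eval 0 at hD
    rw [Polynomial.derivative_C_mul, Polynomial.derivative_comp, Polynomial.eval_mul,
      Polynomial.eval_C, Polynomial.eval_mul, Polynomial.eval_comp, ht0, ht1] at hD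
    simpa [hz, hyw] using hD.symm

end homogenizedForm

/-- Two linear forms vanishing at two given vectors and linearly independent on `Z`. -/
theorem exists_dual_pair {V : Type*} [AddCommGroup V] [Module ℂ V] {Z : Set V}
    (hZ : ∀ W : Submodule ℂ V, Module.finrank ℂ W ≤ 3 → ∃ v ∈ Z, v ∉ W) (x x' : V) :
    ∃ a b : Module.Dual ℂ V, a x = 0 ∧ a x' = 0 ∧ b x = 0 ∧ b x' = 0 ∧
      ∃ w₁ ∈ Z, ∃ w₂ ∈ Z, a w₁ = 0 ∧ b w₁ ≠ 0 ∧ a w₂ ≠ 0 := by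
  have hcard : ∀ s : Finset V, s.card ≤ 3 →
      Module.finrank ℂ (Submodule.span ℂ (s : Set V)) ≤ 3 :=
    fun s hs => (finrank_span_finset_le_card s).trans hs
  obtain ⟨w₁, hw₁, hw₁'⟩ := hZ (Submodule.span ℂ ({x, x'} : Finset V))
    (hcard _ (Finset.card_le_two.trans (by norm_num)))
  obtain ⟨w₂, hw₂, hw₂'⟩ := hZ (Submodule.span ℂ ({x, x', w₁} : Finset V))
    (hcard _ Finset.card_le_three)
  obtain ⟨b, hb, hbk⟩ := Submodule.exists_le_ker_of_notMem hw₁'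
  obtain ⟨a, ha, hak⟩ := Submodule.exists_le_ker_of_notMem hw₂'
  rw [Submodule.span_le] at hbk hak
  exact ⟨a, b, hak (by simp), hak (by simp), hbk (by simp), hbk (by simp), w₁, hw₁, w₂, hw₂,
    hak (by simp), hb, ha⟩

namespace IsCurveGenericPoint

variable {σ Ω : Type*} [Fintype σ] [Field Ω] [Algebra ℂ Ω] {T : Set (MvPolynomial σ ℂ)}
  {l₀ l₁ : Module.Dual ℂ (σ → ℂ)} {ξ : σ → Ω}

theorem linEval_div_not_mem_range (h : IsCurveGenericPoint T l₀ l₁ ξ)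
    {y b : Module.Dual ℂ (σ → ℂ)} (hb : linEval b ξ ≠ 0) {w₁ w₂ : σ → ℂ}
    (hw₁ : w₁ ∈ affinePart T l₀) (hw₂ : w₂ ∈ affinePart T l₀)
    (hy : y (b w₁ • w₂ - b w₂ • w₁) ≠ 0) :
    linEval y ξ / linEval b ξ ∉ Set.range (algebraMap ℂ Ω) := by
  rintro ⟨c, hc⟩
  have h0 := (h.linEval_eq_zero_iff (y - c • b)).1
    (by rw [linEval_sub_smul, hc, div_mul_cancel₀ _ hb, sub_self])
  have h1 : y w₁ = c * b w₁ := by simpa [sub_eq_zero] using h0 w₁ hw₁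
  have h2 : y w₂ = c * b w₂ := by simpa [sub_eq_zero] using h0 w₂ hw₂
  apply hy
  simp only [map_sub, map_smul, smul_eq_mul, h1, h2]
  ring

/-- The number of points from which the projection of the curve is not generically injective. -/
theorem card_le (h : IsCurveGenericPoint T l₀ l₁ ξ) [IsAlgClosed Ω] {e : ℕ}
    (he : ∀ l : Module.Dual ℂ (σ → ℂ), linEval l ξ ≠ 0 →
      {v ∈ affinePart T l₀ | l v = 0}.Finite ∧ {v ∈ affinePart T l₀ | l v = 0}.ncard ≤ e)
    (hT : ∀ G d, MvPolynomial.IsHomogeneous G d → MvPolynomial.aeval ξ G = 0 → G ∈ T)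
    (hspan : ∀ W : Submodule ℂ (σ → ℂ), Module.finrank ℂ W ≤ 3 → ∃ v ∈ affinePart T l₀, v ∉ W)
    (P : Finset (σ → ℂ))
    (hP : ∀ p ∈ P, ∃ β : Ω, β ≠ 0 ∧ ∀ G ∈ T,
      MvPolynomial.aeval (fun i => algebraMap ℂ Ω (p i) + β * ξ i) G = 0)
    (hPe : ∀ l : Module.Dual ℂ (σ → ℂ), linEval l ξ ≠ 0 → (P.filter fun p => l p = 0).card ≤ e) :
    P.card ≤ e + 2 * e * e * e := by
  obtain ⟨x, x', hx, hx'₀, hx'₁, hjet⟩ := h.exists_jet P hP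
  choose! β β' hβ hjet using hjet
  obtain ⟨a, b, hax, hax', hbx, hbx', w₁, hw₁, w₂, hw₂, haw₁, hbw₁, haw₂⟩ :=
    exists_dual_pair hspan x x'
  have hb : linEval b ξ ≠ 0 := fun h0 => hbw₁ ((h.linEval_eq_zero_iff b).1 h0 w₁ hw₁)
  have hau : a (b w₁ • w₂ - b w₂ • w₁) ≠ 0 := by simp [haw₁, hbw₁, haw₂]
  have hw : ∀ p ∈ P, β' p • x + β p • x' ≠ 0 := by
    intro p hp h0
    have h1 := congrArg l₀ h0
    simp only [map_add, map_smul, hx.1, hx'₀, smul_eq_mul, mul_one, mul_zero, add_zero,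
      map_zero] at h1
    have h2 := congrArg l₁ h0
    simp only [map_add, map_smul, h1, hx'₁, smul_eq_mul, mul_one, zero_mul, zero_add,
      map_zero] at h2
    exact hβ p hp h2
  obtain ⟨y, hy⟩ := Module.exists_dual_forall_apply_ne_zero (K := ℂ)
    (fun o : Option P => o.elim (b w₁ • w₂ - b w₂ • w₁) fun p => β' p • x + β p • x') (by
      rintro (_ | ⟨p, hp⟩)
      · exact fun h0 => hau (by rw [show b w₁ • w₂ - b w₂ • w₁ = 0 from h0, map_zero])
      · exact hw p hp)
  have hyu : linEval y ξ / linEval b ξ ∉ Set.range (algebraMap ℂ Ω) :=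
    h.linEval_div_not_mem_range hb hw₁ hw₂ (hy none)
  have hu : linEval a ξ / linEval b ξ ∉ Set.range (algebraMap ℂ Ω) :=
    h.linEval_div_not_mem_range hb hw₁ hw₂ hau
  have := h.isAlgebraic_adjoin hu
  obtain ⟨F, hF, hFuv⟩ := exists_irreducible_aevalAeval_eq_zero (u := linEval a ξ / linEval b ξ)
    (linEval y ξ / linEval b ξ)
  have hle := h.natDegree_le he hb hu hF hFuv
  have hle' := h.natDegree_le he hb hyu
    ((MulEquiv.irreducible_iff (Polynomial.Bivariate.swap (R := ℂ))).2 hF)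
    (by rw [Polynomial.Bivariate.aevalAeval_swap, hFuv])
  have hdeg : F.natDegree ≠ 0 := by
    intro h0
    obtain ⟨f, rfl⟩ := Polynomial.natDegree_eq_zero.1 h0
    rw [Polynomial.aevalAeval_C] at hFuv
    refine transcendental_of_not_mem_range hu ⟨f, ?_, hFuv⟩
    rintro rfl
    exact hF.ne_zero (map_zero _)
  obtain ⟨r, hr0, hrdeg, hr⟩ := Polynomial.exists_discriminant hF hdeg hle hle'
  have hG : homogenizedForm F e a b y ∈ T := by
    refine hT _ _ isHomogeneous_homogenizedForm ?_
    rw [aeval_homogenizedForm (ν := (linEval b ξ)⁻¹) (mul_inv_cancel₀ hb) hle hle',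
      ← div_eq_mul_inv, ← div_eq_mul_inv, hFuv, mul_zero]
  have hroot : ∀ p ∈ P, b p ≠ 0 → r.IsRoot (a p / b p) := by
    intro p hp hbp
    have haz : a (p + β p • x) = a p := by simp [hax]
    have hbz : b (p + β p • x) = b p := by simp [hbx]
    obtain ⟨h0, h1⟩ := hjet p hp _ hG
    have := isRoot_of_homogenizedForm hle hle' (hbz ▸ hbp) (by simp [hax, hax'])
      (by simp [hbx, hbx']) (hy (some ⟨p, hp⟩)) h0 h1
    rw [haz, hbz] at this
    exact hr _ _ this.1 this.2
  have hsub : P ⊆ (P.filter fun p => b p = 0) ∪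
      r.roots.toFinset.biUnion fun u => P.filter fun p => (a - u • b) p = 0 := by
    intro p hp
    by_cases hbp : b p = 0
    · simp [hp, hbp]
    · refine Finset.mem_union_right _ (Finset.mem_biUnion.2 ⟨a p / b p, ?_, ?_⟩)
      · simpa [hr0] using hroot p hp hbp
      · simp [hp, hbp]
  refine (Finset.card_le_card hsub).trans ((Finset.card_union_le _ _).trans
    (add_le_add (hPe b hb) ?_))
  refine (Finset.card_biUnion_le_card_mul _ _ e fun u _ => hPe _ fun h0 => hu ⟨u, ?_⟩).trans ?_
  · rw [linEval_sub_smul] at h0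
    exact ((div_eq_iff hb).2 (sub_eq_zero.1 h0)).symm
  · gcongr
    exact (Multiset.toFinset_card_le _).trans ((Polynomial.card_roots' r).trans hrdeg)

end IsCurveGenericPoint

theorem exists_generic_point {σ : Type} (J : Ideal (MvPolynomial σ ℂ)) [J.IsPrime] :
    ∃ (Ω : Type) (_ : Field Ω) (_ : Algebra ℂ Ω) (_ : IsAlgClosed Ω) (ξ : σ → Ω),
      (∀ G, MvPolynomial.aeval ξ G = 0 ↔ G ∈ J) ∧
        Algebra.IsAlgebraic (Algebra.adjoin ℂ (Set.range ξ)) Ω := by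
  let R := MvPolynomial σ ℂ ⧸ J
  let K := FractionRing R
  let Ω := AlgebraicClosure K
  have hinj : Function.Injective (algebraMap R Ω) := by
    rw [IsScalarTower.algebraMap_eq R K Ω]
    exact (algebraMap K Ω).injective.comp (IsFractionRing.injective R K)
  have : Algebra.IsAlgebraic R Ω := (IsFractionRing.comap_isAlgebraic_iff (A := R) (K := K)).2
    inferInstance
  let φ : MvPolynomial σ ℂ →ₐ[ℂ] Ω := (IsScalarTower.toAlgHom ℂ R Ω).comp (Ideal.Quotient.mkₐ ℂ J)
  let ξ : σ → Ω := fun i => φ (MvPolynomial.X i)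
  have hφ : MvPolynomial.aeval ξ = φ := MvPolynomial.algHom_ext fun i => by simp [ξ]
  have hadj : Algebra.adjoin ℂ (Set.range ξ) = φ.range := by
    rw [Algebra.adjoin_range_eq_range_aeval, hφ]
  refine ⟨Ω, inferInstance, inferInstance, inferInstance, ξ, fun G => ?_, ?_⟩
  · rw [hφ]
    change algebraMap R Ω (Ideal.Quotient.mk J G) = 0 ↔ _
    rw [map_eq_zero_iff _ hinj, Ideal.Quotient.eq_zero_iff_mem]
  · let f : R →+* Algebra.adjoin ℂ (Set.range ξ) :=
      (algebraMap R Ω).codRestrict (Algebra.adjoin ℂ (Set.range ξ)).toSubring fun r => by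
        obtain ⟨G, rfl⟩ := Ideal.Quotient.mk_surjective r
        rw [hadj]
        exact ⟨G, rfl⟩
    refine ⟨fun z => ?_⟩
    obtain ⟨q, hq, hqz⟩ := Algebra.IsAlgebraic.isAlgebraic (R := R) z
    have hf : Function.Injective f := fun r s hrs => hinj (congrArg Subtype.val hrs)
    refine ⟨q.map f, (Polynomial.map_ne_zero_iff hf).2 hq, ?_⟩
    rw [Polynomial.aeval_def, Polynomial.eval₂_map, ← hqz]
    rfl

theorem MvPolynomial.IsHomogeneous.eval_smul {σ : Type*} {G : MvPolynomial σ ℂ} {d : ℕ}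
    (hG : G.IsHomogeneous d) (c : ℂ) (v : σ → ℂ) :
    MvPolynomial.eval (c • v) G = c ^ d * MvPolynomial.eval v G := by
  simpa only [MvPolynomial.coe_aeval_eq_eval, RingHom.coe_coe] using! hG.aeval_mul c v

theorem exists_isHomogeneous_eval_eq {σ : Type*} [Fintype σ] (l : Module.Dual ℂ (σ → ℂ))
    (Q : MvPolynomial σ ℂ) : ∃ (G : MvPolynomial σ ℂ) (d : ℕ), G.IsHomogeneous d ∧
      ∀ v, l v = 1 → MvPolynomial.eval v G = MvPolynomial.eval v Q := by
  refine ⟨∑ k ∈ Finset.range (Q.totalDegree + 1),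
    MvPolynomial.homogeneousComponent k Q * linPoly l ^ (Q.totalDegree - k), Q.totalDegree,
    MvPolynomial.IsHomogeneous.sum _ _ _ fun k hk => ?_, fun v hv => ?_⟩
  · convert (MvPolynomial.homogeneousComponent_isHomogeneous k Q).mul
      ((isHomogeneous_linPoly l).pow (Q.totalDegree - k)) using 1
    have := Finset.mem_range.1 hk
    omega
  · conv_rhs => rw [← MvPolynomial.sum_homogeneousComponent Q]
    simp [hv]

theorem Submodule.exists_le_finrank_eq {V : Type*} [AddCommGroup V] [Module ℂ V]
    [FiniteDimensional ℂ V] (W : Submodule ℂ V) {r : ℕ} (hW : Module.finrank ℂ W ≤ r)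
    (hr : r ≤ Module.finrank ℂ V) : ∃ W' : Submodule ℂ V, W ≤ W' ∧ Module.finrank ℂ W' = r := by
  induction r, hW using Nat.le_induction with
  | base => exact ⟨W, le_rfl, rfl⟩
  | succ k hk ih =>
    obtain ⟨W', hle, hW'⟩ := ih (by omega)
    obtain ⟨v, hv⟩ : ∃ v, v ∉ W' := by
      by_contra! hall
      rw [(Submodule.eq_top_iff'.2 hall), finrank_top] at hW'
      omega
    exact ⟨W' ⊔ Submodule.span ℂ {v}, hle.trans le_sup_left, by
      rw [Submodule.finrank_sup_span_singleton hv, hW']⟩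

section Projective

variable {n : ℕ} {δ : Set (PS ℂ n)}

theorem forall_mem_submodule_eval_eq_zero_iff {G : MvPolynomial (Fin (n + 1)) ℂ} {d : ℕ}
    (hG : G.IsHomogeneous d) {x : PS ℂ n} {v : Fin (n + 1) → ℂ} (hx : x.submodule = ℂ ∙ v) :
    (∀ w ∈ x.submodule, MvPolynomial.eval w G = 0) ↔ MvPolynomial.eval v G = 0 := by
  rw [hx]
  refine ⟨fun h => h v (Submodule.mem_span_singleton_self v), fun h w hw => ?_⟩
  obtain ⟨c, rfl⟩ := Submodule.mem_span_singleton.1 hw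
  rw [hG.eval_smul, h, mul_zero]

theorem mk_mem_iff (hδ : IsAlg δ) {v : Fin (n + 1) → ℂ} (hv : v ≠ 0) :
    Projectivization.mk ℂ v hv ∈ δ ↔ ∀ G ∈ vanishingForms δ, MvPolynomial.eval v G = 0 := by
  refine ⟨fun h G hG => hG.2 _ h v ?_, fun h => ?_⟩
  · rw [Projectivization.submodule_mk]
    exact Submodule.mem_span_singleton_self v
  · obtain ⟨S, hS, rfl⟩ := hδ
    intro f hf
    obtain ⟨d, hd⟩ := hS f hf
    exact (forall_mem_submodule_eval_eq_zero_iff hd (Projectivization.submodule_mk v hv)).2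
      (h f ⟨⟨d, hd⟩, fun x hx => hx f hf⟩)

theorem isAlg_projZeroLocus_singleton {G : MvPolynomial (Fin (n + 1)) ℂ} {d : ℕ}
    (hG : G.IsHomogeneous d) : IsAlg (projZeroLocus {G}) :=
  ⟨{G}, by simpa using ⟨d, hG⟩, rfl⟩

theorem mem_projZeroLocus_singleton {G : MvPolynomial (Fin (n + 1)) ℂ} {d : ℕ}
    (hG : G.IsHomogeneous d) {x : PS ℂ n} :
    x ∈ projZeroLocus {G} ↔ MvPolynomial.eval x.rep G = 0 := by
  rw [← forall_mem_submodule_eval_eq_zero_iff hG x.submodule_eq]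
  simp [projZeroLocus]

/-- The vanishing forms of an irreducible set are a prime set of forms. -/
theorem mem_vanishingForms_or (hδ : IsIrredAlg δ) {G H : MvPolynomial (Fin (n + 1)) ℂ} {d k : ℕ}
    (hG : G.IsHomogeneous d) (hH : H.IsHomogeneous k)
    (h : ∀ x ∈ δ, MvPolynomial.eval x.rep (G * H) = 0) :
    G ∈ vanishingForms δ ∨ H ∈ vanishingForms δ := by
  have hmem : ∀ {G : MvPolynomial (Fin (n + 1)) ℂ} {d : ℕ}, G.IsHomogeneous d →
      δ ⊆ projZeroLocus {G} → G ∈ vanishingForms δ :=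
    fun hG hsub => ⟨⟨_, hG⟩, fun x hx => hsub hx _ rfl⟩
  refine (hδ.2.2 _ _ (isAlg_projZeroLocus_singleton hG) (isAlg_projZeroLocus_singleton hH)
    fun x hx => ?_).imp (hmem hG) (hmem hH)
  have := h x hx
  rw [map_mul, mul_eq_zero] at this
  exact this.imp (mem_projZeroLocus_singleton hG).2 (mem_projZeroLocus_singleton hH).2

/-- The points of projective space at which a linear form vanishes. -/
def formHyperplane (l : Module.Dual ℂ (Fin (n + 1) → ℂ)) : Set (PS ℂ n) :=
  {x | x.submodule ≤ LinearMap.ker l}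

theorem mem_formHyperplane_iff {l : Module.Dual ℂ (Fin (n + 1) → ℂ)} {x : PS ℂ n}
    {v : Fin (n + 1) → ℂ} (hx : x.submodule = ℂ ∙ v) : x ∈ formHyperplane l ↔ l v = 0 := by
  simp [formHyperplane, hx, Submodule.span_singleton_le_iff_mem]

theorem isHypSet_formHyperplane {l : Module.Dual ℂ (Fin (n + 1) → ℂ)} (hl : l ≠ 0) :
    IsHypSet (formHyperplane l) :=
  ⟨LinearMap.ker l, by simpa using Module.Dual.finrank_ker_add_one_of_ne_zero hl, rfl⟩

theorem IsHypSet.exists_formHyperplane {S : Set (PS ℂ n)} (hS : IsHypSet S) :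
    ∃ l : Module.Dual ℂ (Fin (n + 1) → ℂ), l ≠ 0 ∧ S = formHyperplane l := by
  obtain ⟨W, hW, rfl⟩ := hS
  obtain ⟨v, hv⟩ : ∃ v, v ∉ W := by
    by_contra! hall
    rw [(Submodule.eq_top_iff'.2 hall), finrank_top, Module.finrank_fin_fun] at hW
    omega
  obtain ⟨l, hlv, hl⟩ := Submodule.exists_le_ker_of_notMem hv
  have hl0 : l ≠ 0 := by
    rintro rfl
    exact hlv rfl
  have := Module.Dual.finrank_ker_add_one_of_ne_zero hl0
  rw [Module.finrank_fin_fun] at this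
  exact ⟨l, hl0, by rw [formHyperplane, Submodule.eq_of_le_of_finrank_eq hl (by omega)]⟩

theorem IsCurveDeg.infinite {e : ℕ} (hirr : IsIrredAlg δ) (hδ : IsCurveDeg δ e) : δ.Infinite :=
  hδ.1.2.2 δ ⟨hirr, subset_rfl, fun _ _ h h' => h'.antisymm h⟩

theorem ne_zero_of_mem_affinePart {σ : Type*} {T : Set (MvPolynomial σ ℂ)}
    {l₀ : Module.Dual ℂ (σ → ℂ)} {v : σ → ℂ} (hv : v ∈ affinePart T l₀) : v ≠ 0 := by
  rintro rfl
  simpa using hv.1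

/-- A point of `δ` off the hyperplane `l₀ = 0` has a representative in the chart `l₀ = 1`. -/
theorem smul_rep_mem_affinePart {l₀ : Module.Dual ℂ (Fin (n + 1) → ℂ)} {x : PS ℂ n}
    (hx : x ∈ δ) (h0 : l₀ x.rep ≠ 0) : (l₀ x.rep)⁻¹ • x.rep ∈ affinePart (vanishingForms δ) l₀ := by
  refine ⟨by simp [h0], fun G hG => hG.2 x hx _ ?_⟩
  rw [x.submodule_eq]
  exact Submodule.smul_mem _ _ (Submodule.mem_span_singleton_self _)

/-- The set of points of `δ` represented in the chart `l₀ = 1` by elements of a finite set is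
finite. -/
theorem finite_of_smul_rep_mem {l₀ : Module.Dual ℂ (Fin (n + 1) → ℂ)}
    (hfin : (δ ∩ formHyperplane l₀).Finite) {Z : Set (Fin (n + 1) → ℂ)} (hZ : Z.Finite) :
    {x ∈ δ | l₀ x.rep ≠ 0 → (l₀ x.rep)⁻¹ • x.rep ∈ Z}.Finite := by
  have hinj : Set.InjOn (fun x : PS ℂ n => (l₀ x.rep)⁻¹ • x.rep) {x | l₀ x.rep ≠ 0} := by
    intro x hx x' hx' h
    rw [← x.mk_rep, ← x'.mk_rep, Projectivization.mk_eq_mk_iff']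
    refine ⟨l₀ x.rep * (l₀ x'.rep)⁻¹, ?_⟩
    rw [mul_smul]
    exact (congrArg (fun w => l₀ x.rep • w) h.symm).trans (smul_inv_smul₀ hx _)
  refine (hfin.union (Set.Finite.of_finite_image (s := {x : PS ℂ n | l₀ x.rep ≠ 0 ∧
    (l₀ x.rep)⁻¹ • x.rep ∈ Z}) (hZ.subset ?_) (hinj.mono fun x hx => hx.1))).subset ?_
  · rintro _ ⟨x, hx, rfl⟩
    exact hx.2
  · rintro x ⟨hx, hxZ⟩
    by_cases h0 : l₀ x.rep = 0
    · exact Or.inl ⟨hx, (mem_formHyperplane_iff x.submodule_eq).2 h0⟩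
    · exact Or.inr ⟨h0, hxZ h0⟩

end Projective

section Projective

variable {n : ℕ} {δ : Set (PS ℂ n)} {l₀ : Module.Dual ℂ (Fin (n + 1) → ℂ)}

/-- A form vanishing on the chart `l₀ = 1` of an irreducible curve vanishes on the curve. -/
theorem mem_vanishingForms_of_affinePart (hirr : IsIrredAlg δ) (hinf : δ.Infinite)
    (hfin : (δ ∩ formHyperplane l₀).Finite) {G : MvPolynomial (Fin (n + 1)) ℂ} {d : ℕ}
    (hG : G.IsHomogeneous d)
    (h : ∀ v ∈ affinePart (vanishingForms δ) l₀, MvPolynomial.eval v G = 0) :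
    G ∈ vanishingForms δ := by
  refine (mem_vanishingForms_or hirr hG (isHomogeneous_linPoly l₀) fun x hx => ?_).resolve_right
    fun h0 => hinf (hfin.subset fun x hx => ⟨hx, fun v hv => by simpa using h0.2 x hx v hv⟩)
  rw [map_mul, eval_linPoly, mul_eq_zero, or_iff_not_imp_right]
  intro h0
  have := h _ (smul_rep_mem_affinePart hx h0)
  rw [hG.eval_smul] at this
  exact (mul_eq_zero.1 this).resolve_left (pow_ne_zero _ (inv_ne_zero h0))

theorem isPrime_vanishingIdeal_affinePart (hirr : IsIrredAlg δ) (hinf : δ.Infinite)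
    (hfin : (δ ∩ formHyperplane l₀).Finite) :
    (MvPolynomial.vanishingIdeal ℂ (affinePart (vanishingForms δ) l₀)).IsPrime := by
  have hmem : ∀ {Q : MvPolynomial (Fin (n + 1)) ℂ}, Q ∈ MvPolynomial.vanishingIdeal ℂ
      (affinePart (vanishingForms δ) l₀) ↔
      ∀ v ∈ affinePart (vanishingForms δ) l₀, MvPolynomial.eval v Q = 0 :=
    MvPolynomial.mem_vanishingIdeal_iff
  obtain ⟨x, hx, hx0⟩ : ∃ x ∈ δ, l₀ x.rep ≠ 0 := by
    by_contra! hall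
    exact hinf (hfin.subset fun x hx => ⟨hx, (mem_formHyperplane_iff x.submodule_eq).2 (hall x hx)⟩)
  refine ⟨fun htop => ?_, fun {Q₁ Q₂} hQ => ?_⟩
  · have := hmem.1 (htop ▸ Submodule.mem_top : (1 : MvPolynomial (Fin (n + 1)) ℂ) ∈ _) _
      (smul_rep_mem_affinePart hx hx0)
    simp at this
  · obtain ⟨G₁, d₁, hG₁, h₁⟩ := exists_isHomogeneous_eval_eq l₀ Q₁
    obtain ⟨G₂, d₂, hG₂, h₂⟩ := exists_isHomogeneous_eval_eq l₀ Q₂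
    have hprod := mem_vanishingForms_of_affinePart hirr hinf hfin (hG₁.mul hG₂) fun v hv => by
      rw [map_mul, h₁ v hv.1, h₂ v hv.1, ← map_mul]
      exact hmem.1 hQ v hv
    refine (mem_vanishingForms_or hirr hG₁ hG₂ fun x hx => hprod.2 x hx _ ?_).imp
      (fun h => hmem.2 fun v hv => ?_) (fun h => hmem.2 fun v hv => ?_)
    · rw [x.submodule_eq]
      exact Submodule.mem_span_singleton_self _
    · rw [← h₁ v hv.1, hv.2 _ h]
    · rw [← h₂ v hv.1, hv.2 _ h]

theorem exists_isCurveGenericPoint (hirr : IsIrredAlg δ) (hinf : δ.Infinite)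
    (hfin : (δ ∩ formHyperplane l₀).Finite) :
    ∃ (l₁ : Module.Dual ℂ (Fin (n + 1) → ℂ)) (Ω : Type) (_ : Field Ω) (_ : Algebra ℂ Ω)
      (_ : IsAlgClosed Ω) (ξ : Fin (n + 1) → Ω),
      IsCurveGenericPoint (vanishingForms δ) l₀ l₁ ξ := by
  have := hfin.to_subtype
  obtain ⟨l₁, hl₁⟩ := Module.exists_dual_forall_apply_ne_zero (K := ℂ)
    (fun x : ↥(δ ∩ formHyperplane l₀) => x.1.rep) fun x => x.1.rep_nonzero
  have := isPrime_vanishingIdeal_affinePart hirr hinf hfin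
  obtain ⟨Ω, i₁, i₂, i₃, ξ, hξ, halg⟩ := exists_generic_point
    (MvPolynomial.vanishingIdeal ℂ (affinePart (vanishingForms δ) l₀))
  refine ⟨l₁, Ω, i₁, i₂, i₃, ξ, fun G hG => hG.1,
    fun G => (hξ G).trans MvPolynomial.mem_vanishingIdeal_iff, fun c hc h0 h1 => ?_, fun hZ => ?_,
    halg⟩
  · by_contra hne
    have hsub := Projectivization.submodule_mk (K := ℂ) c hne
    have hmem : Projectivization.mk ℂ c hne ∈ δ ∩ formHyperplane l₀ :=
      ⟨(mk_mem_iff hirr.1 hne).2 hc, (mem_formHyperplane_iff hsub).2 h0⟩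
    exact hl₁ ⟨_, hmem⟩ ((mem_formHyperplane_iff (Projectivization.submodule_eq _)).1
      ((mem_formHyperplane_iff hsub).2 h1))
  · exact hinf ((finite_of_smul_rep_mem hfin hZ).subset fun x hx =>
      ⟨hx, smul_rep_mem_affinePart hx⟩)

section GenericPoint

variable {l₁ : Module.Dual ℂ (Fin (n + 1) → ℂ)} {Ω : Type} [Field Ω] [Algebra ℂ Ω]
  {ξ : Fin (n + 1) → Ω}

theorem IsCurveDeg.hyperplane_section {e : ℕ} (hδ : IsCurveDeg δ e)
    (hfin : (δ ∩ formHyperplane l₀).Finite)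
    (h : IsCurveGenericPoint (vanishingForms δ) l₀ l₁ ξ) {l : Module.Dual ℂ (Fin (n + 1) → ℂ)}
    (hl : linEval l ξ ≠ 0) :
    (δ ∩ formHyperplane l).Finite ∧ (δ ∩ formHyperplane l).ncard ≤ e := by
  have hl0 : l ≠ 0 := by
    rintro rfl
    exact hl (by simp [linEval])
  have hf : (δ ∩ formHyperplane l).Finite := by
    refine (finite_of_smul_rep_mem hfin
      (h.finite_zeros (H := linPoly l) (by rwa [aeval_linPoly]))).subset ?_
    rintro x ⟨hx, hxl⟩
    refine ⟨hx, fun h0 => ⟨smul_rep_mem_affinePart hx h0, ?_⟩⟩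
    simp [(mem_formHyperplane_iff x.submodule_eq).1 hxl]
  exact ⟨hf, hδ.2.2 ⟨_, isHypSet_formHyperplane hl0, hf, rfl⟩⟩

theorem IsCurveDeg.affine_hyperplane_section {e : ℕ} (hδ : IsCurveDeg δ e)
    (hfin : (δ ∩ formHyperplane l₀).Finite)
    (h : IsCurveGenericPoint (vanishingForms δ) l₀ l₁ ξ) {l : Module.Dual ℂ (Fin (n + 1) → ℂ)}
    (hl : linEval l ξ ≠ 0) :
    {v ∈ affinePart (vanishingForms δ) l₀ | l v = 0}.Finite ∧
      {v ∈ affinePart (vanishingForms δ) l₀ | l v = 0}.ncard ≤ e := by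
  obtain ⟨hf, hcard⟩ := hδ.hyperplane_section hfin h hl
  let g : PS ℂ n → Fin (n + 1) → ℂ := fun x => (l₀ x.rep)⁻¹ • x.rep
  have hsub : {v ∈ affinePart (vanishingForms δ) l₀ | l v = 0} ⊆ g '' (δ ∩ formHyperplane l) := by
    rintro v ⟨hv, hlv⟩
    have hv0 := ne_zero_of_mem_affinePart hv
    refine ⟨Projectivization.mk ℂ v hv0, ⟨(mk_mem_iff hδ.1.1 hv0).2 hv.2,
      (mem_formHyperplane_iff (Projectivization.submodule_mk v hv0)).2 hlv⟩, ?_⟩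
    obtain ⟨a, ha⟩ := Projectivization.exists_smul_eq_mk_rep ℂ v hv0
    simp only [g, ← ha]
    rw [Units.smul_def, map_smul, hv.1, smul_eq_mul, mul_one, inv_smul_smul₀ a.ne_zero]
  exact ⟨(hf.image g).subset hsub,
    (Set.ncard_le_ncard hsub (hf.image g)).trans ((Set.ncard_image_le hf).trans hcard)⟩

theorem NonPlanar.exists_notMem (hnp : NonPlanar δ) (hn : 2 ≤ n) (hirr : IsIrredAlg δ)
    (hinf : δ.Infinite) (hfin : (δ ∩ formHyperplane l₀).Finite)
    {W : Submodule ℂ (Fin (n + 1) → ℂ)} (hW : Module.finrank ℂ W ≤ 3) :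
    ∃ v ∈ affinePart (vanishingForms δ) l₀, v ∉ W := by
  obtain ⟨W', hle, hW'⟩ := W.exists_le_finrank_eq hW (by rw [Module.finrank_fin_fun]; omega)
  by_contra! hall
  refine hnp _ ⟨W', hW', rfl⟩ fun x hx v hv => ?_
  by_contra hvW
  obtain ⟨l, hlv, hl⟩ := Submodule.exists_le_ker_of_notMem hvW
  have := mem_vanishingForms_of_affinePart hirr hinf hfin (isHomogeneous_linPoly l)
    fun w hw => by simpa using hl (hle (hall w hw))
  exact hlv (by simpa using this.2 x hx v hv)

end GenericPoint

end Projective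

theorem exists_ker_eq_submodule {n : ℕ} (p : PS ℂ (n + 1)) :
    ∃ f : (Fin (n + 2) → ℂ) →ₗ[ℂ] (Fin (n + 1) → ℂ), LinearMap.ker f = p.submodule := by
  have h := p.submodule.finrank_quotient_add_finrank
  rw [p.finrank_submodule, Module.finrank_fin_fun] at h
  let g : ((Fin (n + 2) → ℂ) ⧸ p.submodule) ≃ₗ[ℂ] (Fin (n + 1) → ℂ) :=
    LinearEquiv.ofFinrankEq _ _ (by rw [Module.finrank_fin_fun]; exact Nat.add_right_cancel h)
  exact ⟨g.toLinearMap ∘ₗ p.submodule.mkQ, by rw [LinearEquiv.ker_comp, Submodule.ker_mkQ]⟩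

/-- If the projection from `p` is not generically one-to-one, then the line joining `p` to `v` meets
the curve again for infinitely many `v` on the curve. -/
theorem infinite_secants {n : ℕ} {δ : Set (PS ℂ (n + 1))} {p : PS ℂ (n + 1)}
    {l₀ : Module.Dual ℂ (Fin (n + 2) → ℂ)} (hfin : (δ ∩ formHyperplane l₀).Finite)
    (hbad : ∀ f : (Fin (n + 2) → ℂ) →ₗ[ℂ] (Fin (n + 1) → ℂ),
      LinearMap.ker f = p.submodule → ¬GenOneToOneOn f (δ \ {p})) :
    {v ∈ affinePart (vanishingForms δ) l₀ | ∃ b : ℂ, b ≠ 0 ∧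
      ∀ G ∈ vanishingForms δ, MvPolynomial.eval (p.rep + b • v) G = 0}.Infinite := by
  intro hZ
  obtain ⟨f, hf⟩ := exists_ker_eq_submodule p
  refine hbad f hf ⟨_, finite_of_smul_rep_mem hfin hZ, ?_⟩
  rintro x₁ ⟨⟨hx₁, -⟩, -⟩ x₂ ⟨⟨hx₂, -⟩, hx₂'⟩ ⟨c, hc, hcf⟩
  have hker : x₁.rep - c • x₂.rep ∈ LinearMap.ker f := by simp [hcf]
  rw [hf, p.submodule_eq] at hker
  obtain ⟨d, hd⟩ := Submodule.mem_span_singleton.1 hker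
  by_cases hd0 : d = 0
  · rw [hd0, zero_smul, eq_comm, sub_eq_zero] at hd
    rw [← x₁.mk_rep, ← x₂.mk_rep, Projectivization.mk_eq_mk_iff']
    exact ⟨c, hd.symm⟩
  · refine absurd ⟨hx₂, fun h0 => ⟨smul_rep_mem_affinePart hx₂ h0, d⁻¹ * c * l₀ x₂.rep,
      mul_ne_zero (mul_ne_zero (inv_ne_zero hd0) hc) h0, fun G hG => hG.2 x₁ hx₁ _ ?_⟩⟩ hx₂'
    have : p.rep + (d⁻¹ * c * l₀ x₂.rep) • (l₀ x₂.rep)⁻¹ • x₂.rep = d⁻¹ • x₁.rep := by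
      rw [smul_smul, mul_assoc, mul_inv_cancel₀ h0, mul_one, ← eq_sub_iff_add_eq, mul_smul,
        ← smul_sub, ← hd, inv_smul_smul₀ hd0]
    rw [this, x₁.submodule_eq]
    exact Submodule.smul_mem _ _ (Submodule.mem_span_singleton_self _)

theorem card_le_of_not_genOneToOneOn {n : ℕ} (hn : 2 ≤ n) {e : ℕ} {δ : Set (PS ℂ (n + 1))}
    (hirr : IsIrredAlg δ) (hnp : NonPlanar δ) (hδ : IsCurveDeg δ e) (B : Finset (PS ℂ (n + 1)))
    (hB : (B : Set (PS ℂ (n + 1))) ⊆ {p ∈ δ | ∀ f : (Fin (n + 2) → ℂ) →ₗ[ℂ] (Fin (n + 1) → ℂ),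
          LinearMap.ker f = p.submodule → ¬GenOneToOneOn f (δ \ {p})}) :
    B.card ≤ e + 2 * e * e * e := by
  have hinf := hδ.infinite hirr
  obtain ⟨S, hS, hfin⟩ := hδ.1.2.1
  obtain ⟨l₀, -, rfl⟩ := hS.exists_formHyperplane
  obtain ⟨l₁, Ω, _, _, _, ξ, h⟩ := exists_isCurveGenericPoint hirr hinf hfin
  have hinj : Function.Injective (Projectivization.rep : PS ℂ (n + 1) → _) := fun x x' hx =>
    Projectivization.submodule_injective (by rw [x.submodule_eq, x'.submodule_eq, hx])
  rw [← Finset.card_image_of_injective B hinj]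
  refine h.card_le (fun l hl => hδ.affine_hyperplane_section hfin h hl)
    (fun G d hG h0 => mem_vanishingForms_of_affinePart hirr hinf hfin hG
      ((h.aeval_eq_zero_iff G).1 h0))
    (fun W hW => hnp.exists_notMem (by omega) hirr hinf hfin hW) _ ?_ fun l hl => ?_
  · intro v hv
    obtain ⟨p, hp, rfl⟩ := Finset.mem_image.1 hv
    exact h.exists_secant _ (infinite_secants hfin (hB hp).2)
  · obtain ⟨hf, hcard⟩ := hδ.hyperplane_section hfin h hl
    rw [Finset.filter_image, Finset.card_image_of_injective _ hinj, ← Set.ncard_coe_finset]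
    refine (Set.ncard_le_ncard (fun p hp => ?_) hf).trans hcard
    have hp' := Finset.mem_filter.1 (Finset.mem_coe.1 hp)
    exact ⟨(hB hp'.1).1, (mem_formHyperplane_iff p.submodule_eq).2 hp'.2⟩

/-- Lemma 2.2.
Let `δ` be an irreducible non-planar curve of degree `e` in `ℂPᵈ`, `d ≥ 3` (below `d = n + 1`
with `n ≥ 2`). Then there are at most `O(e^4)` points `p` on `δ` such that the projection
`π_p` restricted to `δ ∖ {p}` is not generically one-to-one. -/
theorem projection_from_curve_point_gen_one_to_one :
    ∃ C : ℝ, 0 < C ∧ ∀ n : ℕ, 2 ≤ n → ∀ e : ℕ, ∀ δ : Set (PS ℂ (n + 1)),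
      IsIrredAlg δ → NonPlanar δ → IsCurveDeg δ e →
      ({p ∈ δ | ∀ f : (Fin (n + 2) → ℂ) →ₗ[ℂ] (Fin (n + 1) → ℂ),
          LinearMap.ker f = p.submodule → ¬GenOneToOneOn f (δ \ {p})}).Finite ∧
      (({p ∈ δ | ∀ f : (Fin (n + 2) → ℂ) →ₗ[ℂ] (Fin (n + 1) → ℂ),
          LinearMap.ker f = p.submodule → ¬GenOneToOneOn f (δ \ {p})}).ncard : ℝ) ≤
        C * (e : ℝ) ^ 4 := by
  refine ⟨3, by norm_num, fun n hn e δ hirr hnp hδ => ?_⟩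
  have hcard := card_le_of_not_genOneToOneOn hn hirr hnp hδ
  set B := {p ∈ δ | ∀ f : (Fin (n + 2) → ℂ) →ₗ[ℂ] (Fin (n + 1) → ℂ),
    LinearMap.ker f = p.submodule → ¬GenOneToOneOn f (δ \ {p})}
  have hfin : B.Finite := by
    by_contra hinf
    obtain ⟨t, ht, htc⟩ := Set.Infinite.exists_subset_card_eq hinf (e + 2 * e * e * e + 1)
    have := hcard t ht
    omega
  refine ⟨hfin, ?_⟩
  have h1 := hcard hfin.toFinset (by simp)
  rw [← Set.ncard_eq_toFinset_card B hfin] at h1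
  have h2 : e + 2 * e * e * e ≤ 3 * e ^ 4 := by
    rcases Nat.eq_zero_or_pos e with rfl | he
    · simp
    · have h3 : e ≤ e ^ 4 := Nat.le_self_pow (by norm_num) e
      have h4 : e ^ 3 ≤ e ^ 4 := Nat.pow_le_pow_right he (by norm_num)
      nlinarith
  exact_mod_cast h1.trans h2
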